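/- Let q be a prime power, k ≥ 2, and let f ∈ F_q[X_1,...,X_k]. Assume that, over the algebraic closure of F_q, f has exactly l distinct irreducible factors (up to associates), that each of these irreducible factors is (associate to) a polynomial with coefficients in F_{q^m}, and that gcd(f, Δ(X_1,...,X_k)) = 1 in F_q[X_1,...,X_k]. Then |N_s − l·q^{ms(k−1)}| = O(q^{ms(k−3/2)}) as s → ∞; precisely, there exist a constant C > 0 and s_0 such that for all s ≥ s_0, |N_s − l·(q^{ms})^{k−1}| ≤ C·(q^{ms})^{k−3/2}, where N_s is the number of points x ∈ F_{q^{ms}}^k with f(x) = 0 and Δ(x) ≠ 0. -/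

import Mathlib

open MvPolynomial

/-- The Moore determinant `Δ(X_1,…,X_k) = det (X_j^{2^{i-1}})_{1 ≤ i,j ≤ k}`
over a commutative ring `R`. -/
noncomputable def MooreDet (R : Type*) [CommRing R] (k : ℕ) : MvPolynomial (Fin k) R :=
  Matrix.det (Matrix.of fun i j : Fin k =>
    (X j : MvPolynomial (Fin k) R) ^ 2 ^ (i : ℕ))

section

open Polynomial

namespace PlaneCurve

section Filtration

variable {k : Type*} [Field k] (F : k[X][X])

/-- The first coordinate function on the affine plane curve `F = 0`. -/
noncomputable def x : AdjoinRoot F := AdjoinRoot.of F X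

/-- The second coordinate function on the affine plane curve `F = 0`. -/
noncomputable def y : AdjoinRoot F := AdjoinRoot.root F

/-- The space of functions spanned by `x ^ i * y ^ j` with `i ≤ n` and `j < deg F`. -/
noncomputable def box (n : ℕ) : Submodule k (AdjoinRoot F) :=
  Submodule.span k (Set.range fun p : Fin (n + 1) × Fin F.natDegree =>
    x F ^ (p.1 : ℕ) * y F ^ (p.2 : ℕ))

/-- The functions which multiply each `box n` into `box (n + w)`. -/
noncomputable def weight (w : ℕ) : Submodule k (AdjoinRoot F) where
  carrier := {a | ∀ n, ∀ b ∈ box F n, a * b ∈ box F (n + w)}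
  add_mem' ha hb n c hc := by
    rw [add_mul]; exact add_mem (ha n c hc) (hb n c hc)
  zero_mem' n c _ := by simp
  smul_mem' r a ha n c hc := by
    rw [smul_mul_assoc]; exact Submodule.smul_mem _ _ (ha n c hc)

variable {F}

lemma mem_box {n i j : ℕ} (hi : i ≤ n) (hj : j < F.natDegree) :
    x F ^ i * y F ^ j ∈ box F n :=
  Submodule.subset_span ⟨(⟨i, by omega⟩, ⟨j, hj⟩), rfl⟩

lemma box_mono {m n : ℕ} (h : m ≤ n) : box F m ≤ box F n := by
  refine Submodule.span_le.2 ?_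
  rintro _ ⟨p, rfl⟩
  exact mem_box (by have := p.1.2; omega) p.2.2

lemma weight_mono {m n : ℕ} (h : m ≤ n) : weight F m ≤ weight F n :=
  fun _ ha r b hb => box_mono (by omega) (ha r b hb)

lemma mul_mem_weight {a b : AdjoinRoot F} {m n : ℕ} (ha : a ∈ weight F m) (hb : b ∈ weight F n) :
    a * b ∈ weight F (m + n) := fun r c hc => by
  have := ha _ _ (hb r c hc)
  rwa [← mul_assoc, add_assoc, add_comm n m] at this

lemma one_mem_weight : (1 : AdjoinRoot F) ∈ weight F 0 := fun n b hb => by simpa using hb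

lemma pow_mem_weight {a : AdjoinRoot F} {m : ℕ} (ha : a ∈ weight F m) (n : ℕ) :
    a ^ n ∈ weight F (n * m) := by
  induction n with
  | zero => simpa using one_mem_weight
  | succ n ih => rw [pow_succ, add_mul, one_mul]; exact mul_mem_weight ih ha

lemma x_mem_weight : x F ∈ weight F 1 := fun n b hb => by
  have : box F n ≤ (box F (n + 1)).comap (LinearMap.mulLeft k (x F)) := by
    refine Submodule.span_le.2 ?_
    rintro _ ⟨p, rfl⟩
    have := mem_box (n := n + 1) (i := p.1 + 1) (by have := p.1.2; omega) p.2.2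
    simpa [pow_succ', mul_assoc] using this
  exact this hb

lemma of_mul_mem_box {g : k[X]} {m n i j : ℕ} (hg : g.natDegree ≤ m) (hi : i ≤ n)
    (hj : j < F.natDegree) : AdjoinRoot.of F g * (x F ^ i * y F ^ j) ∈ box F (n + m) := by
  rw [g.as_sum_range_C_mul_X_pow, map_sum, Finset.sum_mul]
  refine sum_mem fun l hl => ?_
  have : AdjoinRoot.of F (Polynomial.C (g.coeff l) * Polynomial.X ^ l) * (x F ^ i * y F ^ j)
      = g.coeff l • (x F ^ (l + i) * y F ^ j) := by
    rw [map_mul, map_pow, Algebra.smul_def, pow_add]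
    change _ = AdjoinRoot.of F (Polynomial.C _) * _
    simp only [x]; ring
  rw [this]
  refine Submodule.smul_mem _ _ (mem_box ?_ hj)
  have := Finset.mem_range.1 hl
  omega

lemma y_mem_weight (hF : F.Monic) {c : ℕ} (hc : ∀ i, (F.coeff i).natDegree ≤ c) :
    y F ∈ weight F c := fun n b hb => by
  have : box F n ≤ (box F (n + c)).comap (LinearMap.mulLeft k (y F)) := by
    refine Submodule.span_le.2 ?_
    rintro _ ⟨p, rfl⟩
    have hp := p.2.2
    have h1 : y F * (x F ^ (p.1 : ℕ) * y F ^ (p.2 : ℕ)) =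
      x F ^ (p.1 : ℕ) * y F ^ (p.2 + 1 : ℕ) := by ring
    simp only [SetLike.mem_coe, Submodule.mem_comap, LinearMap.mulLeft_apply]
    rw [h1]
    rcases Nat.lt_or_ge (p.2 + 1) F.natDegree with h | h
    · exact mem_box (by have := p.1.2; omega) h
    · have h2 : (p.2 + 1 : ℕ) = F.natDegree := by omega
      have h3 : y F ^ F.natDegree =
          - ∑ i ∈ Finset.range F.natDegree, AdjoinRoot.of F (F.coeff i) * y F ^ i := by
        have := AdjoinRoot.eval₂_root F
        rw [eval₂_eq_sum_range, Finset.sum_range_succ, hF.coeff_natDegree, map_one, one_mul] at this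
        exact eq_neg_of_add_eq_zero_right this
      rw [h2, h3, mul_neg, Finset.mul_sum]
      refine neg_mem (sum_mem fun i hi => ?_)
      rw [mul_left_comm]
      exact of_mul_mem_box (hc i) (by have := p.1.2; omega) (Finset.mem_range.1 hi)
  exact this hb

lemma weight_le_box (hd : 0 < F.natDegree) (w : ℕ) : weight F w ≤ box F w := fun a ha => by
  have := ha 0 1 (by simpa using mem_box (F := F) (le_refl 0) hd)
  simpa using this

lemma smul_mem_weight_monomial (hF : F.Monic) {c : ℕ} (hc : ∀ i, (F.coeff i).natDegree ≤ c)
    (i j : ℕ) : x F ^ i * y F ^ j ∈ weight F (i + j * c) := by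
  have h1 := pow_mem_weight (x_mem_weight (F := F)) i
  have h2 := pow_mem_weight (y_mem_weight hF hc) j
  simpa using mul_mem_weight h1 h2

variable (F) in
/-- The `k`-basis of monomials of the coordinate ring of a plane curve monic in `y`. -/
noncomputable def monomialBasis (hF : F.Monic) :
    Module.Basis (ℕ × Fin F.natDegree) k (AdjoinRoot F) :=
  (Polynomial.basisMonomials k).smulTower
    ((AdjoinRoot.powerBasis' hF).basis.reindex (finCongr (AdjoinRoot.powerBasis'_dim hF)))

lemma monomialBasis_apply (hF : F.Monic) (p : ℕ × Fin F.natDegree) :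
    monomialBasis F hF p = x F ^ p.1 * y F ^ (p.2 : ℕ) := by
  rw [monomialBasis, Module.Basis.smulTower_apply, Algebra.smul_def, Module.Basis.reindex_apply,
    PowerBasis.coe_basis]
  change AdjoinRoot.of F _ * AdjoinRoot.root F ^ _ = _
  simp only [Polynomial.coe_basisMonomials, monomial_one_right_eq_X_pow, map_pow]
  rfl

lemma linearIndependent_monomials (hF : F.Monic) :
    LinearIndependent k fun p : ℕ × Fin F.natDegree => x F ^ p.1 * y F ^ (p.2 : ℕ) := by
  have := (monomialBasis F hF).linearIndependent
  simpa only [funext (monomialBasis_apply hF)] using this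

lemma finrank_box (hF : F.Monic) (n : ℕ) :
    Module.finrank k (box F n) = (n + 1) * F.natDegree := by
  have h : LinearIndependent k fun p : Fin (n + 1) × Fin F.natDegree =>
      x F ^ (p.1 : ℕ) * y F ^ (p.2 : ℕ) := by
    refine (linearIndependent_monomials hF).comp
      (fun p : Fin (n + 1) × Fin F.natDegree => ((p.1 : ℕ), p.2)) ?_
    rintro ⟨a, b⟩ ⟨a', b'⟩ h
    simp only [Prod.mk.injEq] at h
    exact Prod.ext (Fin.ext h.1) h.2
  have := finrank_span_eq_card h
  rw [Fintype.card_prod, Fintype.card_fin, Fintype.card_fin] at this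
  exact this

instance (n : ℕ) : FiniteDimensional k (box F n) :=
  FiniteDimensional.span_of_finite k (Set.finite_range _)

lemma exists_mem_box (hF : F.Monic) (a : AdjoinRoot F) : ∃ n, a ∈ box F n := by
  have h : a ∈ Submodule.span k (Set.range (monomialBasis F hF)) := by
    rw [Module.Basis.span_eq]; trivial
  induction h using Submodule.span_induction with
  | mem a ha =>
    obtain ⟨p, rfl⟩ := ha
    exact ⟨p.1, by rw [monomialBasis_apply]; exact mem_box le_rfl p.2.2⟩
  | zero => exact ⟨0, zero_mem _⟩
  | add a b _ _ ha hb =>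
    obtain ⟨m, hm⟩ := ha
    obtain ⟨n, hn⟩ := hb
    exact ⟨max m n, add_mem (box_mono (le_max_left _ _) hm) (box_mono (le_max_right _ _) hn)⟩
  | smul r a _ ha =>
    obtain ⟨m, hm⟩ := ha
    exact ⟨m, Submodule.smul_mem _ _ hm⟩

lemma exists_mem_weight (hF : F.Monic) {c : ℕ} (hc : ∀ i, (F.coeff i).natDegree ≤ c)
    (a : AdjoinRoot F) : ∃ w, a ∈ weight F w := by
  have h : a ∈ Submodule.span k (Set.range (monomialBasis F hF)) := by
    rw [Module.Basis.span_eq]; trivial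
  induction h using Submodule.span_induction with
  | mem a ha =>
    obtain ⟨p, rfl⟩ := ha
    exact ⟨_, by rw [monomialBasis_apply]; exact smul_mem_weight_monomial hF hc _ _⟩
  | zero => exact ⟨0, zero_mem _⟩
  | add a b _ _ ha hb =>
    obtain ⟨m, hm⟩ := ha
    obtain ⟨n, hn⟩ := hb
    exact ⟨max m n, add_mem (weight_mono (le_max_left _ _) hm)
      (weight_mono (le_max_right _ _) hn)⟩
  | smul r a _ ha =>
    obtain ⟨m, hm⟩ := ha
    exact ⟨m, Submodule.smul_mem _ _ hm⟩

/-- Bézout-type bound: a quotient of the coordinate ring by a function `g` of weight `w` has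
dimension at most `w * deg F`. -/
theorem finrank_le_of_mul_eq_zero [IsDomain (AdjoinRoot F)] (hF : F.Monic)
    {V : Type*} [AddCommGroup V] [Module k V] [FiniteDimensional k V]
    (L : AdjoinRoot F →ₗ[k] V) (hL : Function.Surjective L) {g : AdjoinRoot F} (hg : g ≠ 0)
    {w : ℕ} (hw : g ∈ weight F w) (h0 : ∀ a, L (g * a) = 0) :
    Module.finrank k V ≤ w * F.natDegree := by
  let b := Module.finBasis k V
  choose a ha using fun i => hL (b i)
  choose n hn using fun i => exists_mem_box hF (a i)
  let N := ∑ i, n i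
  have hN : ∀ i, a i ∈ box F N := fun i =>
    box_mono (Finset.single_le_sum (f := n) (fun _ _ => Nat.zero_le _) (Finset.mem_univ i)) (hn i)
  let L' : box F (N + w) →ₗ[k] V := L.domRestrict _
  have hsurj : LinearMap.range L' = ⊤ := by
    rw [eq_top_iff, ← b.span_eq, Submodule.span_le]
    rintro _ ⟨i, rfl⟩
    exact ⟨⟨a i, box_mono (by omega) (hN i)⟩, ha i⟩
  let M : box F N →ₗ[k] LinearMap.ker L' :=
    LinearMap.codRestrict _ (LinearMap.codRestrict (box F (N + w))
      ((LinearMap.mulLeft k g).domRestrict (box F N)) fun c => hw N c c.2) fun c => h0 c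
  have hM : Function.Injective M := by
    intro c c' h
    have : g * (c : AdjoinRoot F) = g * c' :=
      congrArg (fun t : LinearMap.ker L' => ((t : box F (N + w)) : AdjoinRoot F)) h
    exact Subtype.ext (mul_left_cancel₀ hg this)
  have h1 := LinearMap.finrank_le_finrank_of_injective hM
  have h2 := L'.finrank_range_add_finrank_ker
  rw [hsurj, finrank_top, finrank_box hF] at h2
  rw [finrank_box hF] at h1
  nlinarith

end Filtration

section Order

variable {k : Type*} [Field k] {F : k[X][X]} [IsDomain (AdjoinRoot F)]

/-- A function of weight `w` on a plane curve has at most `w * deg F` zeros. -/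
theorem card_le_of_zeros (hF : F.Monic) {g : AdjoinRoot F} (hg : g ≠ 0) {w : ℕ}
    (hw : g ∈ weight F w) (S : Finset (AdjoinRoot F →ₐ[k] k)) (hS : ∀ e ∈ S, e g = 0) :
    S.card ≤ w * F.natDegree := by
  classical
  let L : AdjoinRoot F →ₗ[k] (S → k) := LinearMap.pi fun e => (e : AdjoinRoot F →ₐ[k] k).toLinearMap
  have hL : Function.Surjective L := by
    rw [← LinearMap.range_eq_top]
    by_contra h
    obtain ⟨f, hf, hle⟩ := Submodule.exists_le_ker_of_lt_top _ (lt_top_iff_ne_top.2 h)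
    apply hf
    have hli : LinearIndependent k fun e : S =>
        ((e : AdjoinRoot F →ₐ[k] k) : AdjoinRoot F → k) :=
      (linearIndependent_monoidHom (AdjoinRoot F) k).comp
        (fun e : S => ((e : AdjoinRoot F →ₐ[k] k) : AdjoinRoot F →* k)) fun a b hab => by
          exact Subtype.ext (AlgHom.ext fun t => DFunLike.congr_fun hab t)
    have h0 := Fintype.linearIndependent_iff.1 hli (fun e => f (Pi.single e 1)) (by
      ext a
      have h1 : f (L a) = 0 := hle ⟨a, rfl⟩
      rw [LinearMap.pi_apply_eq_sum_univ f] at h1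
      simp only [Finset.sum_apply, Pi.smul_apply, smul_eq_mul, Pi.zero_apply]
      rw [← h1]
      refine Finset.sum_congr rfl fun e _ => ?_
      rw [smul_eq_mul, mul_comm]
      congr 2
      ext j
      simp [Pi.single_apply, eq_comm])
    refine LinearMap.pi_ext' fun e => LinearMap.ext_ring ?_
    simpa using h0 e
  have := finrank_le_of_mul_eq_zero hF L hL hg hw fun a => by
    ext e
    simp [L, hS e e.2]
  simpa using this

variable {ξ : k}

/-- A function of weight `w` has vanishing order at most `w * deg F` at a smooth point. -/
theorem order_le (hF : F.Monic) (ψ : AdjoinRoot F →ₐ[k] PowerSeries k)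
    (hψ : ψ (x F) = PowerSeries.C ξ + PowerSeries.X) {g : AdjoinRoot F} (hg : g ≠ 0) {w : ℕ}
    (hw : g ∈ weight F w) {N : ℕ} (hN : PowerSeries.X ^ N ∣ ψ g) : N ≤ w * F.natDegree := by
  let L : AdjoinRoot F →ₗ[k] (Fin N → k) :=
    LinearMap.pi fun i => (PowerSeries.coeff (i : ℕ)).comp ψ.toLinearMap
  have hL : Function.Surjective L := by
    intro v
    refine ⟨∑ i, v i • (x F - algebraMap k _ ξ) ^ (i : ℕ), ?_⟩
    have h : ψ (x F - algebraMap k _ ξ) = PowerSeries.X := by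
      rw [map_sub, hψ, AlgHom.commutes]
      change _ - PowerSeries.C ξ = _
      ring
    ext j
    simp only [map_sum, map_smul, L, LinearMap.pi_apply,
      LinearMap.comp_apply, AlgHom.toLinearMap_apply, map_pow, h, PowerSeries.coeff_X_pow]
    simp [Fin.val_inj]
  have := finrank_le_of_mul_eq_zero hF L hL hg hw fun a => by
    ext i
    have : PowerSeries.X ^ N ∣ ψ (g * a) := by rw [map_mul]; exact hN.mul_right _
    exact PowerSeries.X_pow_dvd_iff.1 this i i.2
  simpa using this

lemma injective_of_x_eq (hF : F.Monic) {c : ℕ} (hc : ∀ i, (F.coeff i).natDegree ≤ c)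
    (ψ : AdjoinRoot F →ₐ[k] PowerSeries k)
    (hψ : ψ (x F) = PowerSeries.C ξ + PowerSeries.X) : Function.Injective ψ := by
  rw [injective_iff_map_eq_zero]
  intro a ha
  by_contra h
  obtain ⟨w, hw⟩ := exists_mem_weight hF hc a
  have := order_le hF ψ hψ h hw (N := w * F.natDegree + 1) (by simp [ha])
  omega

/-- Functions of weight `w` which are linearly independent over the constants remain so over the
`q`-th powers, for `q = p ^ e` larger than `w * deg F`. -/
theorem eq_zero_of_sum_mul_pow_eq_zero (hF : F.Monic)
    {c : ℕ} (hc : ∀ i, (F.coeff i).natDegree ≤ c) (ψ : AdjoinRoot F →ₐ[k] PowerSeries k)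
    (hψ : ψ (x F) = PowerSeries.C ξ + PowerSeries.X) {p : ℕ} [Fact p.Prime] [CharP k p]
    {e w : ℕ} (he : w * F.natDegree < p ^ e) {ι : Type*} [Fintype ι] {v : ι → AdjoinRoot F}
    (hv : LinearIndependent k v) (hvw : ∀ i, v i ∈ weight F w) {a : ι → AdjoinRoot F}
    (h : ∑ i, v i * a i ^ p ^ e = 0) (i : ι) : a i = 0 := by
  have hinj := injective_of_x_eq hF hc ψ hψ
  by_contra hi
  have hex : ∃ i, ψ (a i) ≠ 0 := ⟨i, by rwa [Ne, map_eq_zero_iff _ hinj]⟩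
  -- the lowest order occurring among the coefficients
  obtain ⟨i₀, -, hmin⟩ := Finset.exists_min_image Finset.univ (fun i => (ψ (a i)).order)
    ⟨i, Finset.mem_univ i⟩
  have hne : ψ (a i₀) ≠ 0 := by
    intro h0
    obtain ⟨j, hj⟩ := hex
    have := hmin j (Finset.mem_univ j)
    simp only [h0, PowerSeries.order_zero, top_le_iff, PowerSeries.order_eq_top] at this
    exact hj this
  obtain ⟨ν, hν⟩ : ∃ ν : ℕ, (ψ (a i₀)).order = ν :=
    ⟨_, (PowerSeries.coe_toNat_order hne).symm⟩
  have hdiv : ∀ i, PowerSeries.X ^ ν ∣ ψ (a i) := fun i => by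
    rw [PowerSeries.X_pow_dvd_iff]
    intro m hm
    refine PowerSeries.coeff_of_lt_order m (lt_of_lt_of_le ?_ (hmin i (Finset.mem_univ i)))
    rw [hν]; exact_mod_cast hm
  choose b hb using hdiv
  have hb0 : PowerSeries.constantCoeff (b i₀) ≠ 0 := by
    have h1 := (PowerSeries.order_eq_nat.1 hν).1
    rw [hb i₀] at h1
    rwa [PowerSeries.coeff_X_pow_mul', if_pos le_rfl, Nat.sub_self,
      PowerSeries.coeff_zero_eq_constantCoeff_apply] at h1
  have hsum : ∑ i, ψ (v i) * b i ^ p ^ e = 0 := by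
    have h1 := congrArg ψ h
    simp only [map_sum, map_mul, map_pow, map_zero, hb, mul_pow] at h1
    have h2 : (PowerSeries.X ^ ν) ^ p ^ e * ∑ i, ψ (v i) * b i ^ p ^ e = 0 := by
      rw [Finset.mul_sum, ← h1]
      exact Finset.sum_congr rfl fun i _ => by ring
    exact (mul_eq_zero.1 h2).resolve_left (pow_ne_zero _ (pow_ne_zero _ PowerSeries.X_ne_zero))
  let d : ι → k := fun i => PowerSeries.constantCoeff (b i) ^ p ^ e
  have hcharP : CharP (PowerSeries k) p :=
    charP_of_injective_algebraMap (algebraMap k (PowerSeries k)).injective p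
  have hexp : ExpChar (PowerSeries k) p := ExpChar.prime Fact.out
  have hdvd : PowerSeries.X ^ p ^ e ∣ ψ (∑ i, d i • v i) := by
    have h1 : ψ (∑ i, d i • v i) = - ∑ i, ψ (v i) * (b i ^ p ^ e - PowerSeries.C (d i)) := by
      simp only [mul_sub, Finset.sum_sub_distrib, hsum, zero_sub, neg_neg, map_sum, map_smul]
      exact Finset.sum_congr rfl fun i _ => by rw [mul_comm, PowerSeries.smul_eq_C_mul]
    rw [h1, dvd_neg]
    refine Finset.dvd_sum fun i _ => Dvd.dvd.mul_left ?_ _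
    have h2 : b i ^ p ^ e - PowerSeries.C (d i) =
        (b i - PowerSeries.C (PowerSeries.constantCoeff (b i))) ^ p ^ e := by
      rw [sub_pow_expChar_pow, ← map_pow]
    rw [h2]
    exact pow_dvd_pow_of_dvd (PowerSeries.X_dvd_iff.2 (by simp)) _
  have hz : ∑ i, d i • v i = 0 := by
    by_contra hz
    have := order_le hF ψ hψ hz
      (sum_mem fun i _ => Submodule.smul_mem _ _ (hvw i)) hdvd
    omega
  have := Fintype.linearIndependent_iff.1 hv d hz i₀
  exact hb0 (pow_eq_zero_iff (pow_pos (Fact.out : p.Prime).pos e).ne' |>.1 this)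

end Order

/-- Hensel's lemma for an equation over a power series ring. -/
theorem exists_powerSeries_root {R : Type*} [CommRing R] {F : (PowerSeries R)[X]} (hF : F.Monic)
    (a : R) (ha : (F.map (PowerSeries.constantCoeff (R := R))).eval a = 0)
    (ha' : IsUnit ((F.map (PowerSeries.constantCoeff (R := R))).derivative.eval a)) :
    ∃ φ : PowerSeries R, F.eval φ = 0 ∧ PowerSeries.constantCoeff φ = a := by
  have key : ∀ G : (PowerSeries R)[X], PowerSeries.constantCoeff (G.eval (PowerSeries.C a)) =
      (G.map (PowerSeries.constantCoeff (R := R))).eval a := fun G => by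
    rw [Polynomial.eval_map, ← Polynomial.eval₂_hom]; simp
  obtain ⟨φ, h1, h2⟩ := HenselianRing.is_henselian (I := Ideal.span {PowerSeries.X}) F hF
    (PowerSeries.C a)
    (by rw [Ideal.mem_span_singleton, PowerSeries.X_dvd_iff, key, ha])
    (by
      refine IsUnit.map _ (PowerSeries.isUnit_iff_constantCoeff.2 ?_)
      rw [key, ← Polynomial.derivative_map]
      exact ha')
  refine ⟨φ, h1, ?_⟩
  rw [Ideal.mem_span_singleton, PowerSeries.X_dvd_iff, map_sub] at h2
  simpa using sub_eq_zero.1 h2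

section Stepanov

variable {k : Type*} [Field k] [IsAlgClosed k] {F : k[X][X]} [IsDomain (AdjoinRoot F)] {ξ : k}

/-- Stepanov's method: an auxiliary function vanishing on `S`. -/
theorem card_le_of_auxiliary (hF : F.Monic) {c : ℕ} (hc : ∀ i, (F.coeff i).natDegree ≤ c)
    (hd : 0 < F.natDegree) (ψ : AdjoinRoot F →ₐ[k] PowerSeries k)
    (hψ : ψ (x F) = PowerSeries.C ξ + PowerSeries.X) {p : ℕ} [Fact p.Prime] [CharP k p]
    {r s e c' B I : ℕ} {g : Fin F.natDegree → Fin e → AdjoinRoot F}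
    (hg : ∀ j m, g j m ∈ weight F c') (S : Finset (AdjoinRoot F →ₐ[k] k))
    (hx : ∀ φ ∈ S, φ (x F) ^ p ^ (r + s) = φ (x F))
    (hy : ∀ φ ∈ S, ∀ j : Fin F.natDegree,
      φ (y F) ^ (p ^ (r + s) * (j : ℕ)) = ∑ m, φ (g j m) * φ (y F) ^ (p ^ (r + s) * (m : ℕ)))
    (hB : (B + c * F.natDegree) * F.natDegree < p ^ s)
    (hI : e * (p ^ r * (B + c * F.natDegree) + I + c' + 1) < F.natDegree * I * B) :
    S.card ≤ (B + c * F.natDegree + p ^ s * (I + c * F.natDegree)) * F.natDegree := by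
  classical
  have hp : 0 < p := (Fact.out : p.Prime).pos
  set P := p ^ r with hP
  set Q := p ^ s with hQ
  have hPQ : p ^ (r + s) = P * Q := pow_add _ _ _
  have hmon : ∀ {b l N M : ℕ}, b ≤ N → l < F.natDegree → N + c * F.natDegree ≤ M →
      x F ^ b * y F ^ l ∈ weight F M := by
    intro b l N M hb hl hM
    refine weight_mono ?_ (smul_mem_weight_monomial hF hc b l)
    have : l * c ≤ c * F.natDegree := by rw [mul_comm]; exact Nat.mul_le_mul_left _ hl.le
    omega
  let ι₁ := Fin B × Fin F.natDegree
  let ι₂ := Fin I × Fin F.natDegree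
  let W := P * (B + c * F.natDegree) + I + c'
  let t : ι₁ → ι₂ → Fin e → AdjoinRoot F := fun u v m =>
    (x F ^ (u.1 : ℕ) * y F ^ (u.2 : ℕ)) ^ P * (x F ^ (v.1 : ℕ) * g v.2 m)
  have ht : ∀ u v m, t u v m ∈ box F W := by
    intro u v m
    apply weight_le_box hd
    have h1 := pow_mem_weight (hmon u.1.2.le u.2.2 le_rfl) P
    have h2 := pow_mem_weight (x_mem_weight (F := F)) (v.1 : ℕ)
    refine weight_mono ?_ (mul_mem_weight h1 (mul_mem_weight h2 (hg v.2 m)))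
    have := v.1.2
    simp only [W]; omega
  let T : (ι₁ × ι₂ → k) →ₗ[k] (Fin e → box F W) :=
    LinearMap.pi fun m => Fintype.linearCombination k
      (fun uv : ι₁ × ι₂ => (⟨t uv.1 uv.2 m, ht _ _ _⟩ : box F W))
  have hker : LinearMap.ker T ≠ ⊥ := by
    apply LinearMap.ker_ne_bot_of_finrank_lt
    rw [Module.finrank_pi_fintype, Module.finrank_fintype_fun_eq_card]
    simp only [finrank_box hF, Finset.sum_const, Finset.card_univ, Fintype.card_fin, smul_eq_mul,
      ι₁, ι₂, Fintype.card_prod]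
    have := Nat.mul_lt_mul_of_pos_right hI hd
    calc e * ((W + 1) * F.natDegree) = e * (P * (B + c * F.natDegree) + I + c' + 1) * F.natDegree := by
          simp only [W]; ring
      _ < F.natDegree * I * B * F.natDegree := this
      _ = _ := by ring
  obtain ⟨β, hβ, hβ0⟩ := (Submodule.ne_bot_iff _).1 hker
  have hT : ∀ m, ∑ uv : ι₁ × ι₂, β uv • t uv.1 uv.2 m = 0 := by
    intro m
    have h1 := congrArg (fun w : Fin e → box F W => ((w m : box F W) : AdjoinRoot F))
      (LinearMap.mem_ker.1 hβ)
    simpa [T, Fintype.linearCombination_apply] using h1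
  choose γ hγ using fun uv => IsAlgClosed.exists_pow_nat_eq (β uv) (pow_pos hp (r + s))
  let a : ι₁ → AdjoinRoot F := fun u =>
    ∑ v : ι₂, γ (u, v) • (x F ^ (v.1 : ℕ) * y F ^ (v.2 : ℕ))
  let Φ : AdjoinRoot F := ∑ u : ι₁, (x F ^ (u.1 : ℕ) * y F ^ (u.2 : ℕ)) * a u ^ Q
  have hli : ∀ N : ℕ, LinearIndependent k
      fun u : Fin N × Fin F.natDegree => x F ^ (u.1 : ℕ) * y F ^ (u.2 : ℕ) := by
    intro N
    refine (linearIndependent_monomials hF).comp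
      (fun u : Fin N × Fin F.natDegree => ((u.1 : ℕ), u.2)) ?_
    rintro ⟨a, b⟩ ⟨a', b'⟩ h
    simp only [Prod.mk.injEq] at h
    exact Prod.ext (Fin.ext h.1) h.2
  have hΦ0 : Φ ≠ 0 := by
    intro h0
    apply hβ0
    have h1 := eq_zero_of_sum_mul_pow_eq_zero hF hc ψ hψ (p := p) (e := s) hB (hli B)
      (fun u => hmon u.1.2.le u.2.2 le_rfl) h0
    funext uv
    have h2 := Fintype.linearIndependent_iff.1 (hli I) (fun v => γ (uv.1, v)) (h1 uv.1) uv.2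
    rw [← hγ, h2, zero_pow (pow_pos hp _).ne']; rfl
  have hΦw : Φ ∈ weight F (B + c * F.natDegree + Q * (I + c * F.natDegree)) := by
    refine sum_mem fun u _ => mul_mem_weight (hmon u.1.2.le u.2.2 le_rfl) (pow_mem_weight ?_ Q)
    exact sum_mem fun v _ => Submodule.smul_mem _ _ (hmon v.1.2.le v.2.2 le_rfl)
  refine card_le_of_zeros hF hΦ0 hΦw S fun φ hφ => ?_
  have hexp : ExpChar k p := ExpChar.prime Fact.out
  have hpow : φ Φ ^ P = 0 := by
    have h1 : φ Φ ^ P = ∑ u : ι₁, ∑ v : ι₂, β (u, v) *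
        ((φ (x F) ^ (u.1 : ℕ) * φ (y F) ^ (u.2 : ℕ)) ^ P *
          (φ (x F) ^ (v.1 : ℕ) * φ (y F) ^ (P * Q * (v.2 : ℕ)))) := by
      simp only [Φ, a, map_sum, map_mul, map_pow, map_smul, smul_eq_mul]
      rw [hP, sum_pow_char_pow]
      refine Finset.sum_congr rfl fun u _ => ?_
      rw [mul_pow, ← pow_mul, hQ, ← pow_add, add_comm s r, sum_pow_char_pow, Finset.mul_sum]
      refine Finset.sum_congr rfl fun v _ => ?_
      have h3 : (φ (x F) ^ (v.1 : ℕ)) ^ p ^ (r + s) = φ (x F) ^ (v.1 : ℕ) := by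
        rw [← pow_mul, mul_comm, pow_mul, hx φ hφ]
      have h4 : (φ (y F) ^ (v.2 : ℕ)) ^ p ^ (r + s) = φ (y F) ^ (P * Q * (v.2 : ℕ)) := by
        rw [← pow_mul, mul_comm, hPQ]
      rw [mul_pow (γ _), hγ, mul_pow (φ (x F) ^ (v.1 : ℕ)), h3, h4]
      ring
    rw [h1]
    have h2 : ∀ m, φ (∑ uv : ι₁ × ι₂, β uv • t uv.1 uv.2 m) = 0 := fun m => by rw [hT, map_zero]
    calc _ = ∑ m : Fin e, φ (y F) ^ (P * Q * (m : ℕ)) *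
          φ (∑ uv : ι₁ × ι₂, β uv • t uv.1 uv.2 m) := by
          simp only [map_sum, Finset.mul_sum]
          refine Eq.trans ?_ Finset.sum_comm
          refine Eq.trans ?_ (Fintype.sum_prod_type _).symm
          refine Finset.sum_congr rfl fun u _ => Finset.sum_congr rfl fun v _ => ?_
          have := hy φ hφ v.2
          rw [hPQ] at this
          rw [this, Finset.mul_sum, Finset.mul_sum, Finset.mul_sum]
          refine Finset.sum_congr rfl fun m _ => ?_
          simp only [t, map_smul, map_mul, map_pow, smul_eq_mul]
          ring
      _ = 0 := by simp [h2]
  exact pow_eq_zero_iff (pow_pos hp r).ne' |>.1 hpow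

lemma exists_auxiliary_parameters (d c c' e : ℕ) (hd : 0 < d) : ∃ C K : ℕ, ∀ P Q : ℕ,
    P ≤ Q → K ≤ Q → ∃ B I : ℕ, (B + c * d) * d < Q ∧
      e * (P * (B + c * d) + I + c' + 1) < d * I * B ∧
      (B + c * d + Q * (I + c * d)) * d ≤ e * (P * Q) + C * Q := by
  set D := c * d
  set τ := 2 * (4 * d * e * D + 4 * d * e * e + e * (c' + 1) + d) with hτ
  refine ⟨1 + d * τ + D * d, 2 * D * d + 1 + 2 * d + 4 * d * e, fun P Q hPQ hK => ?_⟩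
  have hB : 2 * d * (Q / (2 * d)) ≤ Q := Nat.mul_div_le _ _
  have hB' : Q < 2 * d * (Q / (2 * d) + 1) := Nat.lt_mul_div_succ _ (by omega)
  have hI : d * (e * P / d) ≤ e * P := Nat.mul_div_le _ _
  have hI' : e * P < d * (e * P / d + 1) := Nat.lt_mul_div_succ _ hd
  have hB1 : 1 ≤ Q / (2 * d) := (Nat.one_le_div_iff (by omega)).2 (by omega)
  have hBe : 2 * e ≤ Q / (2 * d) := (Nat.le_div_iff_mul_le (by omega)).2 (by
    have : 2 * e * (2 * d) = 4 * d * e := by ring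
    omega)
  generalize Q / (2 * d) = B at *
  have hQB : Q ≤ 4 * d * B := by nlinarith
  have hJ : e * P / d ≤ e * P := Nat.div_le_self _ _
  generalize e * P / d = J at *
  have h1 : (B + D) * d < Q := by
    have : 2 * ((B + D) * d) = 2 * d * B + 2 * D * d := by ring
    omega
  refine ⟨B, J + τ, h1, ?_, ?_⟩
  · have hPB : P ≤ 4 * d * B := hPQ.trans hQB
    have h2 : e * P * B + d * τ * B + B ≤ d * (J + τ) * B + d * B := by nlinarith
    have h3 : e * D * P ≤ e * D * (4 * d * B) := Nat.mul_le_mul_left _ hPB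
    have h4 : e * J ≤ e * (e * (4 * d * B)) :=
      Nat.mul_le_mul_left _ (hJ.trans (Nat.mul_le_mul_left _ hPB))
    have h5 : 2 * e * τ ≤ B * τ := Nat.mul_le_mul_right _ hBe
    have h6 : e * (c' + 1) ≤ e * (c' + 1) * B := Nat.le_mul_of_pos_right _ hB1
    have h7 : τ * B =
        2 * (e * D * (4 * d * B) + e * (e * (4 * d * B)) + e * (c' + 1) * B + d * B) := by
      rw [hτ]; ring
    have h8 : 1 * (τ * B) ≤ d * (τ * B) := Nat.mul_le_mul_right _ hd
    nlinarith
  · have h2 : d * J * Q ≤ e * P * Q := Nat.mul_le_mul_right _ hI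
    nlinarith

/-- Stepanov's bound for the points of a plane curve whose second coordinate satisfies a
polynomial relation of degree `e` with its conjugate. -/
theorem exists_card_le_of_relation (d c c' e : ℕ) (hd : 0 < d) : ∃ C K : ℕ,
    ∀ (F : k[X][X]) [IsDomain (AdjoinRoot F)] (_ : F.Monic) (_ : F.natDegree = d)
      (_ : ∀ i, (F.coeff i).natDegree ≤ c) (ξ : k) (ψ : AdjoinRoot F →ₐ[k] PowerSeries k)
      (_ : ψ (x F) = PowerSeries.C ξ + PowerSeries.X) (p : ℕ) [Fact p.Prime] [CharP k p]
      (r s : ℕ) (_ : p ^ r ≤ p ^ s) (_ : K ≤ p ^ s)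
      (g : ℕ → ℕ → AdjoinRoot F) (_ : ∀ j m, g j m ∈ weight F c')
      (S : Finset (AdjoinRoot F →ₐ[k] k)) (_ : ∀ φ ∈ S, φ (x F) ^ p ^ (r + s) = φ (x F))
      (_ : ∀ φ ∈ S, ∀ j < d, φ (y F) ^ (p ^ (r + s) * j) =
        ∑ m ∈ Finset.range e, φ (g j m) * φ (y F) ^ (p ^ (r + s) * m)),
      S.card ≤ e * p ^ (r + s) + C * p ^ s := by
  obtain ⟨C, K, h⟩ := exists_auxiliary_parameters d c c' e hd
  refine ⟨C, K, ?_⟩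
  intro F _ hF hFd hc ξ ψ hψ p _ _ r s hrs hK g hg S hx hy
  obtain ⟨B, I, h1, h2, h3⟩ := h _ _ hrs hK
  subst hFd
  rw [pow_add]
  refine (card_le_of_auxiliary hF hc hd ψ hψ (g := fun j m => g j m) (fun j m => hg j m) S hx
    (fun φ hφ j => ?_) h1 h2).trans h3
  rw [hy φ hφ j j.2, Finset.sum_range]

end Stepanov

end PlaneCurve

/-- The elements of `k` fixed by raising to the power `q`. -/
noncomputable def fixedPoints (k : Type*) [Field k] (q : ℕ) : Finset k :=
  open Classical in (Polynomial.X ^ q - Polynomial.X : k[X]).roots.toFinset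

section fixedPoints

variable {k : Type*} [Field k] {q : ℕ}

lemma mem_fixedPoints (hq : 1 < q) {a : k} : a ∈ fixedPoints k q ↔ a ^ q = a := by
  have h : (Polynomial.X ^ q - Polynomial.X : k[X]) ≠ 0 := FiniteField.X_pow_card_sub_X_ne_zero k hq
  simp [fixedPoints, h, sub_eq_zero]

lemma card_fixedPoints [IsAlgClosed k] (hq : 1 < q) (p : ℕ) [CharP k p] (hp : p ∣ q) :
    (fixedPoints k q).card = q := by
  classical
  have h := galois_poly_separable (K := k) p q hp
  rw [fixedPoints, Multiset.toFinset_card_of_nodup (Polynomial.nodup_roots h),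
    ← (IsAlgClosed.splits (Polynomial.X ^ q - Polynomial.X : k[X])).natDegree_eq_card_roots,
    FiniteField.X_pow_card_sub_X_natDegree_eq k hq]

end fixedPoints

namespace PlaneCurve

section Points

variable {k : Type*} [Field k] {F : k[X][X]}

lemma of_mem_weight {g : k[X]} {m : ℕ} (hg : g.natDegree ≤ m) : AdjoinRoot.of F g ∈ weight F m :=
    fun n b hb => by
  have : box F n ≤ (box F (n + m)).comap (LinearMap.mulLeft k (AdjoinRoot.of F g)) := by
    refine Submodule.span_le.2 ?_
    rintro _ ⟨p, rfl⟩
    simp only [SetLike.mem_coe, Submodule.mem_comap, LinearMap.mulLeft_apply]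
    exact of_mul_mem_box hg (by have := p.1.2; omega) p.2.2
  simpa only [Submodule.mem_comap, LinearMap.mulLeft_apply] using this hb

/-- Evaluation at a point of a plane curve. -/
noncomputable def evalPoint (P : k × k) (hP : F.evalEval P.1 P.2 = 0) : AdjoinRoot F →ₐ[k] k :=
  AdjoinRoot.liftAlgHom F (Polynomial.aeval P.1) P.2 (by
    rw [Polynomial.coe_aeval_eq_evalRingHom, Polynomial.eval₂_evalRingHom, hP])

lemma evalPoint_x (P : k × k) (hP : F.evalEval P.1 P.2 = 0) : evalPoint P hP (x F) = P.1 := by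
  rw [evalPoint, x, AdjoinRoot.liftAlgHom_of, Polynomial.aeval_X]

lemma evalPoint_of (P : k × k) (hP : F.evalEval P.1 P.2 = 0) (g : k[X]) :
    evalPoint P hP (AdjoinRoot.of F g) = g.eval P.1 := by
  rw [evalPoint, AdjoinRoot.liftAlgHom_of, Polynomial.coe_aeval_eq_eval]

lemma evalPoint_y (P : k × k) (hP : F.evalEval P.1 P.2 = 0) : evalPoint P hP (y F) = P.2 := by
  rw [evalPoint, y, AdjoinRoot.liftAlgHom_root]

lemma evalPoint_mk (P : k × k) (hP : F.evalEval P.1 P.2 = 0) (G : k[X][X]) :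
    evalPoint P hP (AdjoinRoot.mk F G) = G.evalEval P.1 P.2 := by
  rw [evalPoint, AdjoinRoot.liftAlgHom_mk, Polynomial.coe_aeval_eq_evalRingHom,
    Polynomial.eval₂_evalRingHom]

lemma evalPoint_injective {P P' : k × k} (hP : F.evalEval P.1 P.2 = 0)
    (hP' : F.evalEval P'.1 P'.2 = 0) (h : evalPoint P hP = evalPoint P' hP') : P = P' := by
  have h1 := evalPoint_x P hP
  have h2 := evalPoint_y P hP
  rw [h] at h1 h2
  rw [evalPoint_x] at h1
  rw [evalPoint_y] at h2
  exact Prod.ext h1.symm h2.symm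

/-- The evaluations at a finite set of points of a plane curve. -/
lemma exists_finset_evalPoint (T : Finset (k × k)) (hT : ∀ P ∈ T, F.evalEval P.1 P.2 = 0) :
    ∃ S : Finset (AdjoinRoot F →ₐ[k] k), S.card = T.card ∧
      ∀ φ ∈ S, ∃ P ∈ T, ∃ hP, φ = evalPoint P hP := by
  classical
  refine ⟨T.attach.image fun P => evalPoint P.1 (hT P.1 P.2), ?_, ?_⟩
  · rw [Finset.card_image_of_injective, Finset.card_attach]
    exact fun P P' h => Subtype.ext (evalPoint_injective _ _ h)
  · intro φ hφ
    obtain ⟨P, -, rfl⟩ := Finset.mem_image.1 hφ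
    exact ⟨P, P.2, _, rfl⟩

/-- The curve near a simple point, in terms of power series. -/
theorem exists_algHom_powerSeries (hF : F.Monic) (ξ a : k) (ha : F.evalEval ξ a = 0)
    (ha' : F.derivative.evalEval ξ a ≠ 0) : ∃ ψ : AdjoinRoot F →ₐ[k] PowerSeries k,
      ψ (x F) = PowerSeries.C ξ + PowerSeries.X ∧ PowerSeries.constantCoeff (ψ (y F)) = a := by
  let i : k[X] →ₐ[k] PowerSeries k := Polynomial.aeval (PowerSeries.C ξ + PowerSeries.X)
  have hi : (PowerSeries.constantCoeff (R := k)).comp (i : k[X] →+* PowerSeries k) =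
      evalRingHom ξ := by
    refine Polynomial.ringHom_ext (fun r => ?_) ?_
    · have : i (Polynomial.C r) = PowerSeries.C r := Polynomial.aeval_C _ _
      simp [this]
    · simp [i]
  have key : ∀ G : k[X][X], ((G.map (i : k[X] →+* PowerSeries k)).map
      (PowerSeries.constantCoeff (R := k))).eval a = G.evalEval ξ a := fun G => by
    rw [Polynomial.map_map, hi, Polynomial.eval_map, Polynomial.eval₂_evalRingHom]
  obtain ⟨φ, h1, h2⟩ := exists_powerSeries_root (hF.map (i : k[X] →+* PowerSeries k)) a
    (by rw [key, ha]) (by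
      rw [Polynomial.derivative_map, Polynomial.derivative_map, key]
      exact ha'.isUnit)
  refine ⟨AdjoinRoot.liftAlgHom F i φ (by rwa [Polynomial.eval_map] at h1), ?_, ?_⟩
  · rw [x, AdjoinRoot.liftAlgHom_of]
    exact Polynomial.aeval_X _
  · rwa [y, AdjoinRoot.liftAlgHom_root]

end Points

section Count

variable {k : Type*} [Field k]

/-- The points of a plane curve whose first coordinate is fixed by raising to the power `q`. -/
noncomputable def fibrePoints (F : k[X][X]) (q : ℕ) : Finset (k × k) :=
  open Classical in (fixedPoints k q).biUnion fun a =>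
    (F.map (evalRingHom a)).roots.toFinset.map ⟨fun z => (a, z), Prod.mk_right_injective a⟩

lemma mem_fibrePoints {F : k[X][X]} (hF : F.Monic) {q : ℕ} (hq : 1 < q) {P : k × k} :
    P ∈ fibrePoints F q ↔ P.1 ^ q = P.1 ∧ F.evalEval P.1 P.2 = 0 := by
  obtain ⟨a, z⟩ := P
  simp only [fibrePoints, Finset.mem_biUnion, mem_fixedPoints hq, Finset.mem_map,
    Multiset.mem_toFinset, Polynomial.mem_roots (hF.map _).ne_zero, Polynomial.IsRoot.def,
    Function.Embedding.coeFn_mk, Prod.mk.injEq]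
  simp only [Polynomial.eval_map, Polynomial.eval₂_evalRingHom]
  constructor
  · rintro ⟨b, hb, w, hw, rfl, rfl⟩
    exact ⟨hb, hw⟩
  · rintro ⟨h1, h2⟩
    exact ⟨a, h1, z, h2, rfl, rfl⟩

variable [IsAlgClosed k] {F : k[X][X]} [IsDomain (AdjoinRoot F)]

lemma le_card_fibrePoints (hF : F.Monic) {c : ℕ} (hc : ∀ i, (F.coeff i).natDegree ≤ c)
    {ξ a : k} (ha : F.evalEval ξ a = 0) (ha' : F.derivative.evalEval ξ a ≠ 0)
    {q : ℕ} (hq : 1 < q) (p : ℕ) [CharP k p] (hp : p ∣ q) :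
    F.natDegree * q ≤ (fibrePoints F q).card +
      F.natDegree * ((c + F.natDegree * c) * F.natDegree) := by
  classical
  let D := AdjoinRoot.mk F F.derivative
  have hD0 : D ≠ 0 := by
    intro h
    have := evalPoint_mk (ξ, a) ha F.derivative
    change evalPoint (ξ, a) ha D = _ at this
    rw [h, map_zero] at this
    exact ha' this.symm
  have hD : D ∈ weight F (c + F.natDegree * c) := by
    simp only [D]
    rw [F.derivative.as_sum_range_C_mul_X_pow, map_sum]
    refine sum_mem fun i hi => ?_
    rw [map_mul, map_pow, AdjoinRoot.mk_C, AdjoinRoot.mk_X]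
    have hi' : i ≤ F.natDegree := by
      have := Finset.mem_range.1 hi
      have := F.natDegree_derivative_le
      omega
    refine weight_mono ?_ (mul_mem_weight (m := c) (n := i * c) (of_mem_weight ?_)
      (pow_mem_weight (y_mem_weight hF hc) i))
    · have := Nat.mul_le_mul_right c hi'
      omega
    · rw [Polynomial.coeff_derivative]
      refine (Polynomial.natDegree_mul_le).trans ?_
      have : ((i : k[X]) + 1).natDegree = 0 := by
        have : ((i : k[X]) + 1) = Polynomial.C ((i : k) + 1) := by simp
        rw [this, Polynomial.natDegree_C]
      rw [this, add_zero]
      exact hc _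
  -- the fibres with fewer than `deg F` points
  let bad := (fixedPoints k q).filter fun b => ¬ (F.map (evalRingHom b)).Separable
  have hbad : bad.card ≤ (c + F.natDegree * c) * F.natDegree := by
    have hex : ∀ b ∈ bad, ∃ z, F.evalEval b z = 0 ∧ F.derivative.evalEval b z = 0 := by
      intro b hb
      have hns := (Finset.mem_filter.1 hb).2
      rw [Polynomial.Separable, Polynomial.isCoprime_iff_aeval_ne_zero_of_isAlgClosed k k] at hns
      push Not at hns
      obtain ⟨z, h1, h2⟩ := hns
      refine ⟨z, ?_, ?_⟩
      · rwa [Polynomial.coe_aeval_eq_eval, Polynomial.eval_map, Polynomial.eval₂_evalRingHom] at h1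
      · rwa [Polynomial.coe_aeval_eq_eval, Polynomial.derivative_map, Polynomial.eval_map,
          Polynomial.eval₂_evalRingHom] at h2
    choose! z hz using hex
    obtain ⟨S, hS, hS'⟩ := exists_finset_evalPoint (F := F) (bad.image fun b => (b, z b)) (by
      intro P hP
      obtain ⟨b, hb, rfl⟩ := Finset.mem_image.1 hP
      exact (hz b hb).1)
    rw [Finset.card_image_of_injective _ (fun b b' h => (Prod.mk.inj h).1)] at hS
    rw [← hS]
    refine card_le_of_zeros hF hD0 hD S fun φ hφ => ?_
    obtain ⟨P, hP, hP', rfl⟩ := hS' φ hφ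
    obtain ⟨b, hb, rfl⟩ := Finset.mem_image.1 hP
    rw [evalPoint_mk]
    exact (hz b hb).2
  have hgood : ∀ b ∈ (fixedPoints k q).filter fun b => (F.map (evalRingHom b)).Separable,
      F.natDegree ≤ ((F.map (evalRingHom b)).roots.toFinset.map
        ⟨fun z => (b, z), Prod.mk_right_injective b⟩).card := by
    intro b hb
    rw [Finset.card_map, Multiset.toFinset_card_of_nodup
      (Polynomial.nodup_roots (Finset.mem_filter.1 hb).2),
      ← (IsAlgClosed.splits (F.map (evalRingHom b))).natDegree_eq_card_roots, hF.natDegree_map]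
  have h1 : F.natDegree * ((fixedPoints k q).filter fun b =>
      (F.map (evalRingHom b)).Separable).card ≤ (fibrePoints F q).card := by
    rw [fibrePoints, Finset.card_biUnion]
    · rw [mul_comm, ← smul_eq_mul]
      refine (Finset.card_nsmul_le_sum _ _ _ hgood).trans ?_
      exact Finset.sum_le_sum_of_subset (Finset.filter_subset _ _)
    · intro b _ b' _ hne
      rw [Function.onFun, Finset.disjoint_left]
      rintro P hP hP'
      obtain ⟨z, -, rfl⟩ := Finset.mem_map.1 hP
      obtain ⟨z', -, h⟩ := Finset.mem_map.1 hP'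
      exact hne (Prod.mk.inj h).1.symm
  have h2 := Finset.card_filter_add_card_filter_not (s := fixedPoints k q)
    (fun b => (F.map (evalRingHom b)).Separable)
  rw [card_fixedPoints hq p hp] at h2
  have h3 := Nat.mul_le_mul_left F.natDegree hbad
  have h4 := congrArg (F.natDegree * ·) h2
  simp only [mul_add] at h4
  rw [← h4]
  exact add_le_add h1 h3

end Count

section LangWeil

variable {k : Type*} [Field k]

/-- The coefficients of the quotient of `F` by `Z - y`, as functions on the curve. -/
noncomputable def quotientCoeff (F : k[X][X]) (m : ℕ) : AdjoinRoot F :=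
  ∑ i ∈ Finset.Icc (m + 1) F.natDegree, y F ^ (i - (m + 1)) * AdjoinRoot.of F (F.coeff i)

lemma quotientCoeff_mem_weight {F : k[X][X]} (hF : F.Monic) {c : ℕ}
    (hc : ∀ i, (F.coeff i).natDegree ≤ c) (m : ℕ) :
    quotientCoeff F m ∈ weight F (c + F.natDegree * c) := by
  refine sum_mem fun i hi => weight_mono ?_
    (mul_mem_weight (pow_mem_weight (y_mem_weight hF hc) _) (of_mem_weight (hc i)))
  have : i - (m + 1) ≤ F.natDegree := by have := (Finset.mem_Icc.1 hi).2; omega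
  have := Nat.mul_le_mul_right c this
  omega

/-- Two distinct points of a fibre of a plane curve are related by a polynomial of degree
`deg F - 1`. -/
lemma pow_eq_sum_quotientCoeff {F : k[X][X]} (hF : F.Monic) (hd : 0 < F.natDegree) {P : k × k}
    (hP : F.evalEval P.1 P.2 = 0) {w : k} (hw : F.evalEval P.1 w = 0) (hne : w ≠ P.2) :
    w ^ (F.natDegree - 1) = ∑ m ∈ Finset.range (F.natDegree - 1),
      evalPoint P hP (- quotientCoeff F m) * w ^ m := by
  let G := F.map (evalRingHom P.1)
  have hev : ∀ z, G.eval z = F.evalEval P.1 z := fun z => by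
    rw [Polynomial.eval_map, Polynomial.eval₂_evalRingHom]
  have hG : G.Monic := hF.map _
  have hGd : G.natDegree = F.natDegree := hF.natDegree_map _
  have h1 : (Polynomial.X - Polynomial.C P.2) * (G /ₘ (Polynomial.X - Polynomial.C P.2)) = G :=
    Polynomial.mul_divByMonic_eq_iff_isRoot.2 (by rw [Polynomial.IsRoot.def, hev, hP])
  have h2 : (G /ₘ (Polynomial.X - Polynomial.C P.2)).eval w = 0 := by
    have h3 := congrArg (Polynomial.eval w) h1
    rw [Polynomial.eval_mul, hev, hw] at h3
    refine (mul_eq_zero.1 h3).resolve_left ?_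
    simpa [sub_eq_zero] using hne
  have h3 : (G /ₘ (Polynomial.X - Polynomial.C P.2)).natDegree = F.natDegree - 1 := by
    rw [Polynomial.natDegree_divByMonic _ (Polynomial.monic_X_sub_C _), hGd,
      Polynomial.natDegree_X_sub_C]
  have h4 : (G /ₘ (Polynomial.X - Polynomial.C P.2)).coeff (F.natDegree - 1) = 1 := by
    rw [Polynomial.coeff_divByMonic_X_sub_C, hGd, Nat.sub_add_cancel hd, Finset.Icc_self,
      Finset.sum_singleton, Nat.sub_self, pow_zero, one_mul, ← hGd, hG.coeff_natDegree]
  rw [Polynomial.eval_eq_sum_range, h3, Finset.sum_range_succ, h4, one_mul] at h2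
  rw [eq_neg_of_add_eq_zero_right h2, ← Finset.sum_neg_distrib]
  refine Finset.sum_congr rfl fun m _ => ?_
  rw [map_neg, neg_mul, quotientCoeff, map_sum, Polynomial.coeff_divByMonic_X_sub_C, hGd]
  congr 2
  refine Finset.sum_congr rfl fun i _ => ?_
  rw [map_mul, map_pow, evalPoint_y, evalPoint_of, Polynomial.coeff_map,
    Polynomial.coe_evalRingHom]

lemma evalEval_pow {F : k[X][X]} {p : ℕ} [Fact p.Prime] [CharP k p] {n : ℕ}
    (hfix : ∀ i j, ((F.coeff i).coeff j) ^ p ^ n = (F.coeff i).coeff j) (a z : k) :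
    F.evalEval a z ^ p ^ n = F.evalEval (a ^ p ^ n) (z ^ p ^ n) := by
  have : ExpChar k p := ExpChar.prime Fact.out
  have h := Polynomial.map_mapRingHom_evalEval (iterateFrobenius k p n) F a z
  have h1 : F.map (mapRingHom (iterateFrobenius k p n)) = F := by
    ext i j
    simp [iterateFrobenius_def, hfix]
  rw [h1] at h
  simpa [iterateFrobenius_def] using h.symm

variable [IsAlgClosed k]

open Classical in
/-- The Hasse–Weil bound for plane curves, with an unspecified constant depending only on the
degrees of the equation. -/
theorem exists_card_rational_points (p : ℕ) [Fact p.Prime] [CharP k p] (d c : ℕ) (hd : 0 < d) :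
    ∃ C K : ℕ, ∀ (F : k[X][X]) (_ : IsDomain (AdjoinRoot F)) (_ : F.Monic) (_ : F.natDegree = d)
      (_ : ∀ i, (F.coeff i).natDegree ≤ c) (ξ a : k) (_ : F.evalEval ξ a = 0)
      (_ : F.derivative.evalEval ξ a ≠ 0) (r s : ℕ) (_ : p ^ r ≤ p ^ s) (_ : K ≤ p ^ s)
      (_ : 1 < p ^ (r + s))
      (_ : ∀ i j, ((F.coeff i).coeff j) ^ p ^ (r + s) = (F.coeff i).coeff j),
      ((fibrePoints F (p ^ (r + s))).filter fun P => P.2 ^ p ^ (r + s) = P.2).card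
          ≤ p ^ (r + s) + C * p ^ s ∧
        p ^ (r + s) ≤ ((fibrePoints F (p ^ (r + s))).filter
          fun P => P.2 ^ p ^ (r + s) = P.2).card + C * p ^ s := by
  obtain ⟨C₁, K₁, H₁⟩ := exists_card_le_of_relation (k := k) d c (d * c) 1 hd
  obtain ⟨C₂, K₂, H₂⟩ := exists_card_le_of_relation (k := k) d c (c + d * c) (d - 1) hd
  refine ⟨C₁ + C₂ + d * ((c + d * c) * d), K₁ + K₂, ?_⟩
  intro F hdom hF hFd hc ξ a ha ha' r s hrs hK hq hfix
  obtain ⟨ψ, hψ, -⟩ := exists_algHom_powerSeries hF ξ a ha ha'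
  set q := p ^ (r + s) with hqdef
  have hpq : p ∣ q := dvd_pow_self p (by rintro h; rw [hqdef, h] at hq; simp at hq)
  have hmem : ∀ P ∈ fibrePoints F q, P.1 ^ q = P.1 ∧ F.evalEval P.1 P.2 = 0 :=
    fun P hP => (mem_fibrePoints hF hq).1 hP
  have hlow := le_card_fibrePoints hF hc ha ha' hq p hpq
  rw [hFd] at hlow
  have hsplit := Finset.card_filter_add_card_filter_not (s := fibrePoints F q)
    (fun P => P.2 ^ q = P.2)
  have hN : ((fibrePoints F q).filter fun P => P.2 ^ q = P.2).card ≤ 1 * q + C₁ * p ^ s := by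
    obtain ⟨S, hS, hS'⟩ := exists_finset_evalPoint (F := F)
      ((fibrePoints F q).filter fun P => P.2 ^ q = P.2)
      (fun P hP => (hmem P (Finset.mem_filter.1 hP).1).2)
    rw [← hS]
    refine H₁ F hF hFd hc ξ ψ hψ p r s hrs (by omega) (fun j _ => y F ^ (min j d))
      (fun j _ => weight_mono (Nat.mul_le_mul_right c (min_le_right j d))
        (pow_mem_weight (y_mem_weight hF hc) _)) S ?_ ?_
    · intro φ hφ
      obtain ⟨P, hP, hP', rfl⟩ := hS' φ hφ
      rw [evalPoint_x]
      exact (hmem P (Finset.mem_filter.1 hP).1).1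
    · intro φ hφ j hj
      obtain ⟨P, hP, hP', rfl⟩ := hS' φ hφ
      rw [map_pow, evalPoint_y, pow_mul, (Finset.mem_filter.1 hP).2, min_eq_left hj.le]
      simp
  have hM : ((fibrePoints F q).filter fun P => ¬ P.2 ^ q = P.2).card
      ≤ (d - 1) * q + C₂ * p ^ s := by
    obtain ⟨S, hS, hS'⟩ := exists_finset_evalPoint (F := F)
      ((fibrePoints F q).filter fun P => ¬ P.2 ^ q = P.2)
      (fun P hP => (hmem P (Finset.mem_filter.1 hP).1).2)
    rw [← hS]
    refine H₂ F hF hFd hc ξ ψ hψ p r s hrs (by omega)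
      (fun j m => if j < d - 1 then (if j = m then 1 else 0) else - quotientCoeff F m)
      ?_ S ?_ ?_
    · intro j m
      have h1 : (1 : AdjoinRoot F) ∈ weight F (c + d * c) :=
        weight_mono (Nat.zero_le _) one_mem_weight
      have h2 : quotientCoeff F m ∈ weight F (c + d * c) := by
        rw [← hFd]; exact quotientCoeff_mem_weight hF hc m
      split_ifs
      · exact h1
      · exact zero_mem _
      · exact neg_mem h2
    · intro φ hφ
      obtain ⟨P, hP, hP', rfl⟩ := hS' φ hφ
      rw [evalPoint_x]
      exact (hmem P (Finset.mem_filter.1 hP).1).1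
    · intro φ hφ j hj
      obtain ⟨P, hP, hP', rfl⟩ := hS' φ hφ
      rw [evalPoint_y]
      simp only [pow_mul]
      rcases Nat.lt_or_ge j (d - 1) with h | h
      · simp only [h, if_true]
        rw [Finset.sum_eq_single_of_mem j (Finset.mem_range.2 h)
          (fun m _ hm => by rw [if_neg hm.symm, map_zero, zero_mul]), if_pos rfl, map_one, one_mul]
      · have hj' : j = F.natDegree - 1 := by omega
        simp only [if_neg (not_lt.2 h)]
        rw [hj', ← hFd]
        refine pow_eq_sum_quotientCoeff hF (by omega) hP' ?_ (Finset.mem_filter.1 hP).2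
        have h5 := evalEval_pow hfix P.1 P.2
        rw [hP', (hmem P (Finset.mem_filter.1 hP).1).1, zero_pow (by omega)] at h5
        exact h5.symm
  have hs1 : 1 ≤ p ^ s := Nat.one_le_pow _ _ (Fact.out : p.Prime).pos
  have h6 : d * ((c + d * c) * d) * 1 ≤ d * ((c + d * c) * d) * p ^ s := Nat.mul_le_mul_left _ hs1
  have h7 : d * q = (d - 1) * q + q := by
    obtain ⟨d', rfl⟩ := Nat.exists_eq_succ_of_ne_zero hd.ne'
    simp [Nat.succ_mul]
  generalize ((fibrePoints F q).filter fun P => P.2 ^ q = P.2).card = N at *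
  generalize d * ((c + d * c) * d) = X at *
  simp only [add_mul]
  constructor
  · omega
  · omega

end LangWeil

section Spread

lemma coeff_coeff_swap {R : Type*} [CommRing R] (G : R[X][X]) (i j : ℕ) :
    ((Polynomial.Bivariate.swap G).coeff i).coeff j = (G.coeff j).coeff i := by
  induction G using Polynomial.induction_on' with
  | add p q hp hq => simp only [map_add, Polynomial.coeff_add, hp, hq]
  | monomial n f =>
    induction f using Polynomial.induction_on' with
    | add p q hp hq => simp only [map_add, Polynomial.coeff_add, hp, hq]
    | monomial m r =>
      rw [Polynomial.Bivariate.swap_monomial_monomial]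
      simp only [Polynomial.coeff_monomial]
      split_ifs <;> simp [Polynomial.coeff_monomial, *]

lemma natDegree_swap_le_iff {R : Type*} [CommRing R] {G : R[X][X]} {c : ℕ} :
    (Polynomial.Bivariate.swap G).natDegree ≤ c ↔ ∀ j, (G.coeff j).natDegree ≤ c := by
  simp only [Polynomial.natDegree_le_iff_coeff_eq_zero]
  constructor
  · intro h j N hN
    rw [← coeff_coeff_swap, h N hN, Polynomial.coeff_zero]
  · intro h N hN
    ext j
    rw [coeff_coeff_swap, h j N hN, Polynomial.coeff_zero]

lemma natDegree_coeff_le_of_mul {R : Type*} [CommRing R] [IsDomain R] {G H : R[X][X]}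
    (hG : G ≠ 0) (hH : H ≠ 0) {c : ℕ} (h : ∀ j, ((G * H).coeff j).natDegree ≤ c) (j : ℕ) :
    (G.coeff j).natDegree ≤ c := by
  rw [← natDegree_swap_le_iff, map_mul, Polynomial.natDegree_mul (by simpa) (by simpa)] at h
  exact natDegree_swap_le_iff.1 (le_trans (Nat.le_add_right _ _) h) j

/-- Expansion of a polynomial at `ξ`, as a power series. -/
noncomputable def expand {R : Type*} [CommRing R] (ξ : R) : R[X] →+* PowerSeries R :=
  eval₂RingHom PowerSeries.C (PowerSeries.C ξ + PowerSeries.X)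

section

variable {R S : Type*} [CommRing R] [CommRing S]

lemma map_expand (f : R →+* S) (ξ : R) (g : R[X]) :
    PowerSeries.map f (expand ξ g) = expand (f ξ) (g.map f) := by
  induction g using Polynomial.induction_on' with
  | add p q hp hq => simp only [map_add, Polynomial.map_add, hp, hq]
  | monomial n r => simp [expand]

lemma constantCoeff_comp_expand (ξ : R) :
    (PowerSeries.constantCoeff (R := R)).comp (expand ξ) = evalRingHom ξ := by
  refine Polynomial.ringHom_ext (fun r => ?_) ?_ <;> simp [expand]

lemma map_eval₂_expand (f : R →+* S) (ξ : R) (φ : PowerSeries R) (G : R[X][X]) :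
    PowerSeries.map f (G.eval₂ (expand ξ) φ) =
      (G.map (mapRingHom f)).eval₂ (expand (f ξ)) (PowerSeries.map f φ) := by
  rw [Polynomial.hom_eval₂, Polynomial.eval₂_map]
  congr 1
  refine RingHom.ext fun g => ?_
  simp [map_expand]

lemma exists_expand_root {F : R[X][X]} (hF : F.Monic) (ξ a : R) (ha : F.evalEval ξ a = 0)
    (ha' : IsUnit (F.derivative.evalEval ξ a)) :
    ∃ φ : PowerSeries R, F.eval₂ (expand ξ) φ = 0 := by
  have key : ∀ G : R[X][X], ((G.map (expand ξ)).map
      (PowerSeries.constantCoeff (R := R))).eval a = G.evalEval ξ a := fun G => by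
    rw [Polynomial.map_map, constantCoeff_comp_expand, Polynomial.eval_map,
      Polynomial.eval₂_evalRingHom]
  obtain ⟨φ, h1, -⟩ := exists_powerSeries_root (hF.map (expand ξ)) a
    (by rw [key, ha]) (by
      rw [Polynomial.derivative_map, Polynomial.derivative_map, key]
      exact ha')
  exact ⟨φ, by rwa [Polynomial.eval_map] at h1⟩

/-- The Taylor coefficients of the monomials along a branch `φ` of a curve. -/
noncomputable def branchMatrix (ξ : R) (φ : PowerSeries R) (N c d : ℕ) :
    Matrix (Fin N) (Fin (c + 1) × Fin d) R :=
  Matrix.of fun n p => PowerSeries.coeff n (expand ξ Polynomial.X ^ (p.1 : ℕ) * φ ^ (p.2 : ℕ))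

lemma map_branchMatrix (f : R →+* S) (ξ : R) (φ : PowerSeries R) (N c d : ℕ) :
    (branchMatrix ξ φ N c d).map f = branchMatrix (f ξ) (PowerSeries.map f φ) N c d := by
  ext n p
  simp only [branchMatrix, Matrix.map_apply, Matrix.of_apply]
  rw [← PowerSeries.coeff_map, map_mul, map_pow, map_pow, map_expand, Polynomial.map_X]

end

lemma branchMatrix_mulVec_injective {k : Type*} [Field k] {F : k[X][X]} [IsDomain (AdjoinRoot F)]
    (hF : F.Monic) {c : ℕ} (hc : ∀ i, (F.coeff i).natDegree ≤ c) (ξ : k) (φ : PowerSeries k)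
    (hφ : F.eval₂ (expand ξ) φ = 0) {v : Fin (c + 1) × Fin F.natDegree → k}
    (hv : (branchMatrix ξ φ ((c + F.natDegree * c) * F.natDegree + 1) c F.natDegree).mulVec v = 0) :
    v = 0 := by
  let i : k[X] →ₐ[k] PowerSeries k := Polynomial.aeval (PowerSeries.C ξ + PowerSeries.X)
  have hi : (i : k[X] →+* PowerSeries k) = expand ξ := by
    refine Polynomial.ringHom_ext (fun r => ?_) ?_
    · have : i (Polynomial.C r) = PowerSeries.C r := Polynomial.aeval_C _ _
      simp [this, expand]
    · simp [i, expand]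
  let ψ : AdjoinRoot F →ₐ[k] PowerSeries k := AdjoinRoot.liftAlgHom F i φ (by rw [hi, hφ])
  have hψx : ψ (x F) = PowerSeries.C ξ + PowerSeries.X := by
    rw [x, AdjoinRoot.liftAlgHom_of]; exact Polynomial.aeval_X _
  have hψy : ψ (y F) = φ := by rw [y, AdjoinRoot.liftAlgHom_root]
  let g : AdjoinRoot F := ∑ p, v p • (x F ^ (p.1 : ℕ) * y F ^ (p.2 : ℕ))
  have hg : g ∈ weight F (c + F.natDegree * c) := by
    refine sum_mem fun p _ => Submodule.smul_mem _ _
      (weight_mono ?_ (smul_mem_weight_monomial hF hc _ _))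
    have := Nat.mul_le_mul_right c p.2.2.le
    have := p.1.2
    omega
  have hdvd : PowerSeries.X ^ ((c + F.natDegree * c) * F.natDegree + 1) ∣ ψ g := by
    rw [PowerSeries.X_pow_dvd_iff]
    intro n hn
    have := congrFun hv ⟨n, hn⟩
    rw [Pi.zero_apply] at this
    rw [← this]
    simp only [g, map_sum, map_smul, map_mul, map_pow, hψx, hψy, Matrix.mulVec, dotProduct,
      branchMatrix, Matrix.of_apply, smul_eq_mul]
    refine Finset.sum_congr rfl fun p _ => ?_
    simp [expand, mul_comm]
  have h0 : g = 0 := by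
    by_contra hne
    have := order_le hF ψ hψx hne hg hdvd
    omega
  have hli : LinearIndependent k
      fun u : Fin (c + 1) × Fin F.natDegree => x F ^ (u.1 : ℕ) * y F ^ (u.2 : ℕ) := by
    refine (linearIndependent_monomials hF).comp
      (fun u : Fin (c + 1) × Fin F.natDegree => ((u.1 : ℕ), u.2)) ?_
    rintro ⟨a, b⟩ ⟨a', b'⟩ h
    simp only [Prod.mk.injEq] at h
    exact Prod.ext (Fin.ext h.1) h.2
  exact funext (Fintype.linearIndependent_iff.1 hli v h0)

lemma isDomain_of_branchMatrix {L : Type*} [Field L] {F : L[X][X]}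
    (hF : F.Monic) (hd : 0 < F.natDegree) {c : ℕ} (hc : ∀ i, (F.coeff i).natDegree ≤ c) (ξ : L)
    (φ : PowerSeries L) (hφ : F.eval₂ (expand ξ) φ = 0) {N : ℕ}
    (hM : ∀ v, (branchMatrix ξ φ N c F.natDegree).mulVec v = 0 → v = 0) :
    IsDomain (AdjoinRoot F) := by
  refine AdjoinRoot.isDomain_of_prime (Irreducible.prime ?_)
  have key : ∀ G H : L[X][X], G.Monic → H.Monic → G * H = F → 0 < H.natDegree →
      G.eval₂ (expand ξ) φ ≠ 0 := by
    intro G H hG hH hGH hHd h0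
    have hGd : G.natDegree < F.natDegree := by
      rw [← hGH, hG.natDegree_mul hH]; omega
    have hGc : ∀ j, (G.coeff j).natDegree ≤ c :=
      natDegree_coeff_le_of_mul hG.ne_zero hH.ne_zero (by rwa [hGH])
    have h1 := hM (fun p => (G.coeff p.2).coeff p.1) (by
      ext n
      rw [Pi.zero_apply, ← map_zero (PowerSeries.coeff (n : ℕ)), ← h0]
      rw [Polynomial.eval₂_eq_sum_range' _ hGd]
      simp only [map_sum, Matrix.mulVec, dotProduct, branchMatrix, Matrix.of_apply]
      rw [Fintype.sum_prod_type_right, Finset.sum_range]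
      refine Finset.sum_congr rfl fun j _ => ?_
      rw [(G.coeff j).as_sum_range' (c + 1) (Nat.lt_succ_of_le (hGc j)), map_sum, Finset.sum_mul,
        map_sum, Finset.sum_range]
      refine Finset.sum_congr rfl fun i _ => ?_
      have h2 : expand ξ (Polynomial.monomial (i : ℕ) ((G.coeff j).coeff i)) =
          PowerSeries.C ((G.coeff j).coeff i) * expand ξ Polynomial.X ^ (i : ℕ) := by
        simp [expand]
      rw [h2, mul_assoc, PowerSeries.coeff_C_mul, mul_comm])
    apply hG.ne_zero
    ext j i
    simp only [Polynomial.coeff_zero]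
    by_cases hj : j < F.natDegree
    · by_cases hi : i < c + 1
      · exact congrFun h1 (⟨i, hi⟩, ⟨j, hj⟩)
      · exact Polynomial.coeff_eq_zero_of_natDegree_lt (by have := hGc j; omega)
    · rw [Polynomial.coeff_eq_zero_of_natDegree_lt (by omega : G.natDegree < j),
        Polynomial.coeff_zero]
  rw [hF.irreducible_iff_natDegree']
  refine ⟨fun h => by simp [h] at hd, fun G H hG hH hGH hmem => ?_⟩
  have hdeg : G.natDegree + H.natDegree = F.natDegree := by rw [← hGH, hG.natDegree_mul hH]
  rw [Finset.mem_Ioc] at hmem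
  have h2 : G.eval₂ (expand ξ) φ * H.eval₂ (expand ξ) φ = 0 := by
    rw [← Polynomial.eval₂_mul, hGH, hφ]
  rcases mul_eq_zero.1 h2 with h | h
  · exact key G H hG hH hGH hmem.1 h
  · exact key H G hH hG (by rw [mul_comm, hGH]) (by omega) h

lemma natDegree_coeff_map_le {R S : Type*} [CommRing R] [CommRing S] (f : R →+* S) {F : R[X][X]}
    {c : ℕ} (hc : ∀ j, (F.coeff j).natDegree ≤ c) (j : ℕ) :
    ((F.map (mapRingHom f)).coeff j).natDegree ≤ c := by
  rw [Polynomial.coeff_map]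
  exact Polynomial.natDegree_map_le.trans (hc j)

/-- If a curve over a domain `R` with a simple point is generically irreducible, then so are its
specializations outside of the zero set of some nonzero element of `R`. -/
theorem exists_forall_isDomain {R K : Type*} [CommRing R] [IsDomain R]
    [Field K] [Algebra R K] [IsFractionRing R K] {F : R[X][X]} (hF : F.Monic)
    (hd : 0 < F.natDegree)
    (hdom : IsDomain (AdjoinRoot (F.map (mapRingHom (algebraMap R K)))))
    (ξ a : R) (ha : F.evalEval ξ a = 0) (ha' : IsUnit (F.derivative.evalEval ξ a)) :
    ∃ h : R, h ≠ 0 ∧ ∀ (L : Type*) [Field L] (f : R →+* L), f h ≠ 0 →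
      IsDomain (AdjoinRoot (F.map (mapRingHom f))) := by
  classical
  obtain ⟨φ, hφ⟩ := exists_expand_root hF ξ a ha ha'
  let c := (Polynomial.Bivariate.swap F).natDegree
  have hc : ∀ j, (F.coeff j).natDegree ≤ c := natDegree_swap_le_iff.1 le_rfl
  let F' := F.map (mapRingHom (algebraMap R K))
  have hF' : F'.natDegree = F.natDegree := hF.natDegree_map _
  let N := (c + F.natDegree * c) * F.natDegree + 1
  let M := branchMatrix ξ φ N c F.natDegree
  have hinj : ∀ v, (M.map (algebraMap R K)).mulVec v = 0 → v = 0 := by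
    have h1 := fun v => branchMatrix_mulVec_injective (v := v) (hF.map _)
      (natDegree_coeff_map_le (algebraMap R K) hc) (algebraMap R K ξ)
      (PowerSeries.map (algebraMap R K) φ) (by rw [← map_eval₂_expand, hφ, map_zero])
    rw [hF'] at h1
    simp only [M, map_branchMatrix]
    exact h1
  obtain ⟨L', hL'⟩ : ∃ L' : Matrix (Fin (c + 1) × Fin F.natDegree) (Fin N) K,
      L' * M.map (algebraMap R K) = 1 := by
    obtain ⟨g, hg⟩ := (Matrix.toLin' (M.map (algebraMap R K))).exists_leftInverse_of_injective
      (by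
        rw [LinearMap.ker_eq_bot']
        intro v hv
        exact hinj v (by simpa using hv))
    refine ⟨LinearMap.toMatrix' g, ?_⟩
    rw [← LinearMap.toMatrix'_toLin' (M.map (algebraMap R K)), ← LinearMap.toMatrix'_comp, hg,
      LinearMap.toMatrix'_id]
  obtain ⟨⟨h, hh⟩, hint⟩ := IsLocalization.exist_integer_multiples_of_finite (nonZeroDivisors R)
    (fun p : (Fin (c + 1) × Fin F.natDegree) × Fin N => L' p.1 p.2)
  choose l hl using hint
  have hLM : (Matrix.of fun p n => l (p, n)) * M = h • 1 := by
    apply Matrix.map_injective (IsFractionRing.injective R K)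
    dsimp only
    rw [Matrix.map_mul]
    have h1 : (Matrix.of fun p n => l (p, n)).map (algebraMap R K) = algebraMap R K h • L' := by
      ext p n
      simp only [Matrix.map_apply, Matrix.of_apply, hl, Matrix.smul_apply]
      rw [Algebra.smul_def, smul_eq_mul]
    rw [h1, Matrix.smul_mul, hL']
    ext p q
    by_cases hpq : p = q <;> simp [hpq]
  refine ⟨h, nonZeroDivisors.ne_zero hh, fun L _ f hfh => ?_⟩
  have hd' : (F.map (mapRingHom f)).natDegree = F.natDegree := hF.natDegree_map _
  refine isDomain_of_branchMatrix (N := N) (hF.map _) (by rwa [hd'])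
    (natDegree_coeff_map_le f hc) (f ξ)
    (PowerSeries.map f φ) (by rw [← map_eval₂_expand, hφ, map_zero]) ?_
  rw [hd', ← map_branchMatrix]
  intro v hv
  have h2 := congrArg (fun A => (A.map f).mulVec v) hLM
  rw [Matrix.map_mul, ← Matrix.mulVec_mulVec] at h2
  change Matrix.mulVec _ ((branchMatrix ξ φ N c F.natDegree).map f |>.mulVec v) = _ at h2
  rw [hv, Matrix.mulVec_zero] at h2
  have h3 : (h • (1 : Matrix (Fin (c + 1) × Fin F.natDegree) (Fin (c + 1) × Fin F.natDegree) R)).map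
      f = f h • 1 := by
    ext p q
    by_cases hpq : p = q <;> simp [hpq]
  rw [h3, Matrix.smul_mulVec, Matrix.one_mulVec] at h2
  exact (smul_eq_zero.1 h2.symm).resolve_left hfh

end Spread

end PlaneCurve

namespace MvPolynomial

section Shear

variable {k : Type*} [Field k] {n : ℕ}

/-- The algebra endomorphism `X_i ↦ X_i + c X_0 ^ (u ^ i)` for `i ≠ 0`, `X_0 ↦ X_0`. -/
noncomputable def shearHom (n u : ℕ) (c : k) :
    MvPolynomial (Fin (n + 1)) k →ₐ[k] MvPolynomial (Fin (n + 1)) k :=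
  MvPolynomial.aeval fun i ↦ if i = 0 then MvPolynomial.X 0
    else MvPolynomial.X i + c • MvPolynomial.X 0 ^ u ^ (i : ℕ)

lemma shearHom_comp (u : ℕ) (c : k) :
    (shearHom n u c).comp (shearHom n u (-c)) = AlgHom.id _ _ := by
  unfold shearHom
  rw [comp_aeval, ← MvPolynomial.aeval_X_left]
  ext i v
  cases i using Fin.cases <;> simp

/-- The triangular automorphism `X_i ↦ X_i + X_0 ^ (u ^ i)` for `i ≠ 0`, `X_0 ↦ X_0`. -/
noncomputable def shear (k : Type*) [Field k] (n u : ℕ) :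
    MvPolynomial (Fin (n + 1)) k ≃ₐ[k] MvPolynomial (Fin (n + 1)) k :=
  AlgEquiv.ofAlgHom (shearHom n u 1) (shearHom n u (-1))
    (shearHom_comp u 1) (by simpa using shearHom_comp u (-1 : k))

lemma shear_X (u : ℕ) (i : Fin (n + 1)) :
    shear k n u (MvPolynomial.X i) = if i = 0 then MvPolynomial.X 0
      else MvPolynomial.X i + MvPolynomial.X 0 ^ u ^ (i : ℕ) := by
  simp [shear, shearHom]

lemma finSuccEquiv_shear_X_leadingCoeff (u : ℕ) (i : Fin (n + 1)) (hu : 0 < u) :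
    (finSuccEquiv k n (shear k n u (MvPolynomial.X i))).leadingCoeff = 1 ∧
    (finSuccEquiv k n (shear k n u (MvPolynomial.X i))).natDegree = u ^ (i : ℕ) := by
  rw [shear_X]
  cases i using Fin.cases with
  | zero => simp [finSuccEquiv_X_zero]
  | succ i =>
    have : 0 < u ^ ((i : ℕ) + 1) := by positivity
    simp only [Fin.succ_ne_zero, if_false, map_add, map_pow, finSuccEquiv_X_succ,
      finSuccEquiv_X_zero, Fin.val_succ]
    rw [add_comm]
    exact ⟨leadingCoeff_X_pow_add_C this, natDegree_X_pow_add_C⟩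

lemma finSuccEquiv_shear_monomial (u : ℕ) (hu : 0 < u) (v : Fin (n + 1) →₀ ℕ) {a : k}
    (ha : a ≠ 0) :
    (finSuccEquiv k n (shear k n u (monomial v a))).leadingCoeff = MvPolynomial.C a ∧
    (finSuccEquiv k n (shear k n u (monomial v a))).natDegree =
      ∑ i : Fin (n + 1), u ^ (i : ℕ) * v i := by
  rw [monomial_eq, Finsupp.prod_fintype _ _ (fun i ↦ pow_zero _)]
  have hne : ∀ i, finSuccEquiv k n (shear k n u (MvPolynomial.X i)) ≠ 0 := fun i h ↦ by
    have := (finSuccEquiv_shear_X_leadingCoeff (k := k) u i hu).1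
    rw [h] at this
    simp at this
  have hC : shear k n u (MvPolynomial.C a) = MvPolynomial.C a := (shear k n u).commutes a
  have hC' : finSuccEquiv k n (MvPolynomial.C a) = Polynomial.C (MvPolynomial.C a) :=
    (finSuccEquiv k n).commutes a
  simp only [map_mul, map_prod, map_pow, hC, hC']
  constructor
  · simp [leadingCoeff_mul, leadingCoeff_prod, leadingCoeff_pow,
      (finSuccEquiv_shear_X_leadingCoeff (k := k) u _ hu).1]
  · rw [natDegree_mul (by simpa using ha)
      (Finset.prod_ne_zero_iff.2 fun i _ ↦ pow_ne_zero _ (hne i)),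
      natDegree_prod _ _ (fun i _ ↦ pow_ne_zero _ (hne i))]
    simp [(finSuccEquiv_shear_X_leadingCoeff (k := k) u _ hu).2, mul_comm]

lemma sum_pow_mul_ne {u : ℕ} (hu : 1 < u) {v w : Fin (n + 1) →₀ ℕ} (hv : ∀ i, v i < u)
    (hw : ∀ i, w i < u) (hne : v ≠ w) :
    ∑ i : Fin (n + 1), u ^ (i : ℕ) * v i ≠ ∑ i : Fin (n + 1), u ^ (i : ℕ) * w i := by
  intro h
  refine hne <| Finsupp.ext <| congrFun <| List.ofFn_inj.mp ?_
  apply Nat.ofDigits_inj_of_len_eq hu (by simp) (by grind) (by grind)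
  simpa only [Nat.ofDigits_eq_sum_mapIdx, List.mapIdx_eq_ofFn, List.get_ofFn, List.length_ofFn,
    Fin.val_cast, mul_comm, List.sum_ofFn] using! h

/-- A sufficiently twisted shear makes a nonzero polynomial monic in the first variable, up to
one of its own coefficients. -/
theorem exists_leadingCoeff_shear {f : MvPolynomial (Fin (n + 1)) k} (hf : f ≠ 0) {u : ℕ}
    (hu : 1 < u) (hfu : f.totalDegree < u) :
    ∃ v ∈ f.support, (finSuccEquiv k n (shear k n u f)).leadingCoeff =
      MvPolynomial.C (MvPolynomial.coeff v f) := by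
  have hu0 : 0 < u := by omega
  set D : (Fin (n + 1) →₀ ℕ) → ℕ := fun v ↦ ∑ i : Fin (n + 1), u ^ (i : ℕ) * v i with hD
  obtain ⟨v, hv, hmax⟩ := Finset.exists_max_image f.support D (support_nonempty.mpr hf)
  refine ⟨v, hv, ?_⟩
  have hlt : ∀ w ∈ f.support, ∀ i, w i < u := fun w hw i ↦
    lt_of_le_of_lt ((monomial_le_degreeOf i hw).trans (degreeOf_le_totalDegree f i)) hfu
  have hne : ∀ w ∈ f.support, MvPolynomial.coeff w f ≠ 0 := fun w hw ↦ mem_support_iff.1 hw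
  nth_rw 1 [← f.support_sum_monomial_coeff]
  rw [← Finset.add_sum_erase _ _ hv, map_add, map_add, map_sum, map_sum, add_comm,
    leadingCoeff_add_of_degree_lt, (finSuccEquiv_shear_monomial u hu0 v (hne v hv)).1]
  have hv0 : finSuccEquiv k n (shear k n u (monomial v (MvPolynomial.coeff v f))) ≠ 0 := by
    intro h0
    have := (finSuccEquiv_shear_monomial u hu0 v (hne v hv)).1
    rw [h0] at this
    exact hne v hv (by simpa using this.symm)
  refine lt_of_le_of_lt (degree_sum_le _ _) ((Finset.sup_lt_iff ?_).2 ?_)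
  · exact Ne.bot_lt fun h ↦ hv0 (degree_eq_bot.mp h)
  · intro w hw
    obtain ⟨hwv, hw⟩ := Finset.mem_erase.1 hw
    apply degree_lt_degree
    rw [(finSuccEquiv_shear_monomial u hu0 v (hne v hv)).2,
      (finSuccEquiv_shear_monomial u hu0 w (hne w hw)).2]
    exact lt_of_le_of_ne (hmax w hw) (sum_pow_mul_ne hu (hlt w hw) (hlt v hv) hwv)

/-- The map on points induced by `shear`. -/
def shearPoint {k : Type*} [Semiring k] (u : ℕ) (x : Fin (n + 1) → k) : Fin (n + 1) → k :=
  fun i ↦ if i = 0 then x 0 else x i + x 0 ^ u ^ (i : ℕ)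

lemma eval_shear (u : ℕ) (x : Fin (n + 1) → k) (f : MvPolynomial (Fin (n + 1)) k) :
    MvPolynomial.eval x (shear k n u f) = MvPolynomial.eval (shearPoint u x) f := by
  have : (MvPolynomial.aeval x).comp (shear k n u).toAlgHom =
      MvPolynomial.aeval (shearPoint u x) := by
    ext i
    simp only [AlgHom.comp_apply, AlgEquiv.toAlgHom_apply, shear_X, shearPoint,
      MvPolynomial.aeval_X]
    split_ifs <;> simp
  simpa [MvPolynomial.aeval_eq_eval] using! congrArg (fun φ ↦ φ f) this

lemma map_shear (σ : k →+* k) (u : ℕ) (f : MvPolynomial (Fin (n + 1)) k) :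
    MvPolynomial.map σ (shear k n u f) = shear k n u (MvPolynomial.map σ f) := by
  induction f using MvPolynomial.induction_on with
  | C a =>
    have hC : ∀ a, shear k n u (MvPolynomial.C a) = MvPolynomial.C a := (shear k n u).commutes
    rw [hC, MvPolynomial.map_C, hC]
  | add f g hf hg => simp only [map_add, hf, hg]
  | mul_X f i hf =>
    simp only [map_mul, hf, shear_X, MvPolynomial.map_X]
    split_ifs <;> simp

lemma shearPoint_bijOn {S : Set k} (hadd : ∀ a ∈ S, ∀ b ∈ S, a + b ∈ S)
    (hneg : ∀ a ∈ S, -a ∈ S) (hpow : ∀ a ∈ S, ∀ m : ℕ, a ^ m ∈ S) (u : ℕ) :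
    Set.BijOn (shearPoint (n := n) u) {x | ∀ i, x i ∈ S} {x | ∀ i, x i ∈ S} := by
  refine ⟨fun x hx i ↦ ?_, fun x _ y _ hxy ↦ ?_, fun x hx ↦ ?_⟩
  · unfold shearPoint
    split_ifs
    · exact hx 0
    · exact hadd _ (hx i) _ (hpow _ (hx 0) _)
  · have h0 : x 0 = y 0 := by simpa [shearPoint] using congrFun hxy 0
    funext i
    have := congrFun hxy i
    by_cases hi : i = 0
    · rw [hi, h0]
    · simpa [shearPoint, hi, h0] using this
  · refine ⟨fun i ↦ if i = 0 then x 0 else x i + -(x 0 ^ u ^ (i : ℕ)), fun i ↦ ?_, ?_⟩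
    · beta_reduce
      split_ifs
      · exact hx 0
      · exact hadd _ (hx i) _ (hneg _ (hpow _ (hx 0) _))
    · funext i
      by_cases hi : i = 0
      · simp [shearPoint, hi]
      · simp [shearPoint, hi]

end Shear

end MvPolynomial

section RationalPoints

variable {k : Type*} [Field k]

/-- The points of affine space with all coordinates fixed by the `q`-power map. -/
noncomputable def ratPoints (k : Type*) [Field k] (n q : ℕ) : Finset (Fin n → k) :=
  Fintype.piFinset fun _ ↦ fixedPoints k q

lemma mem_ratPoints {n q : ℕ} (hq : 1 < q) {x : Fin n → k} :
    x ∈ ratPoints k n q ↔ ∀ i, x i ^ q = x i := by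
  simp [ratPoints, mem_fixedPoints hq]

lemma card_ratPoints [IsAlgClosed k] {n q : ℕ} (hq : 1 < q) (p : ℕ) [CharP k p] (hp : p ∣ q) :
    (ratPoints k n q).card = q ^ n := by
  simp [ratPoints, card_fixedPoints hq p hp]

open Classical in
lemma card_ratPoints_filter_le [IsAlgClosed k] {n q : ℕ} (hq : 1 < q) (p : ℕ) [CharP k p]
    (hp : p ∣ q) {δ : MvPolynomial (Fin n) k} (hδ : δ ≠ 0) :
    ((ratPoints k n q).filter fun x ↦ MvPolynomial.eval x δ = 0).card * q
      ≤ δ.totalDegree * q ^ n := by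
  have h := schwartz_zippel_totalDegree hδ (fixedPoints k q)
  rw [card_fixedPoints hq p hp, div_le_div_iff₀ (by positivity) (by positivity)] at h
  have h' : ((((ratPoints k n q).filter fun x ↦ MvPolynomial.eval x δ = 0).card * q : ℕ) : ℚ≥0)
      ≤ ((δ.totalDegree * q ^ n : ℕ) : ℚ≥0) := by
    push_cast
    convert h
    rfl
  exact_mod_cast h'

lemma sum_ratPoints_succ {M : Type*} [AddCommMonoid M] {n q : ℕ} (hq : 1 < q)
    (φ : (Fin (n + 1) → k) → M) :
    ∑ b ∈ ratPoints k (n + 1) q, φ b =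
      ∑ x ∈ fixedPoints k q, ∑ y ∈ ratPoints k n q, φ (Fin.cons x y) := by
  rw [← Finset.sum_product']
  refine (Finset.sum_bij (fun P _ ↦ Fin.cons P.1 P.2) ?_ ?_ ?_ ?_).symm
  · rintro ⟨x, y⟩ h
    rw [Finset.mem_product, mem_ratPoints hq, mem_fixedPoints hq] at h
    rw [mem_ratPoints hq]
    intro i
    cases i using Fin.cases with
    | zero => simpa using h.1
    | succ i => simpa using h.2 i
  · rintro ⟨x, y⟩ _ ⟨x', y'⟩ _ h
    exact Prod.ext (Fin.cons_injective2 h).1 (Fin.cons_injective2 h).2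
  · intro b hb
    rw [mem_ratPoints hq] at hb
    refine ⟨(b 0, Fin.tail b), ?_, by simp⟩
    rw [Finset.mem_product, mem_ratPoints hq, mem_fixedPoints hq]
    exact ⟨hb 0, fun i ↦ hb i.succ⟩
  · intros
    rfl

open Classical in
/-- The number of `q`-rational roots of a polynomial. -/
noncomputable def ratRoots (g : k[X]) (q : ℕ) : ℕ :=
  ((fixedPoints k q).filter fun z ↦ g.eval z = 0).card

lemma ratRoots_le {g : k[X]} (hg : g ≠ 0) (q : ℕ) : ratRoots g q ≤ g.natDegree := by
  classical
  refine le_trans ?_ (g.card_roots')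
  rw [ratRoots]
  refine le_trans (Finset.card_le_card ?_) (Multiset.toFinset_card_le g.roots)
  intro z hz
  simpa [hg] using (Finset.mem_filter.1 hz).2

open Classical in
lemma card_fibrePoints_filter {F : k[X][X]} (hF : F.Monic) {q : ℕ} (hq : 1 < q) :
    ((PlaneCurve.fibrePoints F q).filter fun P ↦ P.2 ^ q = P.2).card =
      ∑ x ∈ fixedPoints k q, ratRoots (F.map (evalRingHom x)) q := by
  rw [Finset.card_eq_sum_card_fiberwise (f := Prod.fst) (t := fixedPoints k q)]
  · refine Finset.sum_congr rfl fun x hx ↦ ?_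
    rw [ratRoots]
    refine (Finset.card_bij (fun z _ ↦ (x, z)) ?_ ?_ ?_).symm
    · intro z hz
      rw [Finset.mem_filter, mem_fixedPoints hq] at hz
      rw [Finset.mem_filter, Finset.mem_filter, PlaneCurve.mem_fibrePoints hF hq]
      refine ⟨⟨⟨(mem_fixedPoints hq).1 hx, ?_⟩, hz.1⟩, rfl⟩
      rw [← hz.2, Polynomial.eval_map, ← eval₂_evalRingHom]
    · intro z _ z' _ h
      exact (Prod.ext_iff.1 h).2
    · rintro ⟨x', z⟩ h
      rw [Finset.mem_filter, Finset.mem_filter, PlaneCurve.mem_fibrePoints hF hq] at h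
      obtain ⟨⟨⟨h1, h2⟩, h3⟩, rfl⟩ := h
      refine ⟨z, ?_, rfl⟩
      rw [Finset.mem_filter, mem_fixedPoints hq]
      refine ⟨h3, ?_⟩
      rw [← h2, Polynomial.eval_map, ← eval₂_evalRingHom]
  · intro P hP
    have := (PlaneCurve.mem_fibrePoints hF hq).1 (Finset.mem_filter.1 hP).1
    exact (mem_fixedPoints hq).2 this.1

end RationalPoints

namespace MvPolynomial

section Cone

variable {k : Type*} [Field k] {n : ℕ}

/-- The substitution `x_0 ↦ X`, `x_{i+1} ↦ t_i π(X)`. -/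
noncomputable def cone (n : ℕ) (π : k[X]) :
    MvPolynomial (Fin (n + 1)) k →+* (MvPolynomial (Fin n) k)[X] :=
  eval₂Hom (Polynomial.C.comp MvPolynomial.C)
    (Fin.cons Polynomial.X
      fun i ↦ Polynomial.C (MvPolynomial.X i) * π.map MvPolynomial.C)

lemma evalRingHom_comp_cone (π : k[X]) {ξ : k} (hξ : π.eval ξ = 0) :
    (evalRingHom (MvPolynomial.C ξ)).comp (cone n π) =
      MvPolynomial.C.comp (MvPolynomial.eval (Fin.cons ξ 0)) := by
  ext i
  · simp [cone]
  · cases i using Fin.cases with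
    | zero => simp [cone]
    | succ i => simp [cone, Polynomial.eval_map, hξ]

lemma evalRingHom_comp_mapRingHom_comp_cone (π : k[X]) (t : Fin n → k) (x : k) :
    (evalRingHom x).comp ((mapRingHom (MvPolynomial.eval t)).comp (cone n π)) =
      MvPolynomial.eval (Fin.cons x fun i ↦ t i * π.eval x) := by
  have h : (MvPolynomial.eval t).comp MvPolynomial.C = RingHom.id k := by ext; simp
  ext i
  · simp [cone]
  · cases i using Fin.cases with
    | zero => simp [cone]
    | succ i => simp [cone, Polynomial.map_map, h]

lemma coeff_mem_of_cone (σ : k →+* k) {π : k[X]} (hπ : π.map σ = π) {t : Fin n → k}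
    (ht : ∀ i, σ (t i) = t i) (b : MvPolynomial (Fin (n + 1)) k)
    (hb : MvPolynomial.map σ b = b) :
    ((cone n π b).map (MvPolynomial.eval t)).map σ = (cone n π b).map (MvPolynomial.eval t) := by
  have h : (mapRingHom σ).comp ((mapRingHom (MvPolynomial.eval t)).comp (cone n π)) =
      ((mapRingHom (MvPolynomial.eval t)).comp (cone n π)).comp (MvPolynomial.map σ) := by
    have h : (MvPolynomial.eval t).comp MvPolynomial.C = RingHom.id k := by ext; simp
    ext i : 2
    · simp [cone]
    · cases i using Fin.cases with
      | zero => simp [cone]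
      | succ i =>
        simp only [cone, RingHom.comp_apply, eval₂Hom_X', Fin.cons_succ, map_mul,
          coe_mapRingHom, Polynomial.map_C, Polynomial.map_map, h, Polynomial.map_id,
          MvPolynomial.map_X, MvPolynomial.eval_X, ht, hπ]
  have := congrArg (fun φ ↦ φ b) h
  simpa [hb] using this

/-- The substitution `x_{i+1} ↦ π(x_0) x_{i+1}`. -/
noncomputable def dilate (n : ℕ) (π : k[X]) :
    MvPolynomial (Fin (n + 1)) k →+* MvPolynomial (Fin (n + 1)) k :=
  eval₂Hom MvPolynomial.C
    (Fin.cons (MvPolynomial.X 0)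
      fun i ↦ Polynomial.aeval (MvPolynomial.X 0) π * MvPolynomial.X i.succ)

lemma eval_aeval_X {m : ℕ} (π : k[X]) (b : Fin m → k) (i : Fin m) :
    MvPolynomial.eval b (Polynomial.aeval (MvPolynomial.X i) π) = π.eval (b i) := by
  rw [← MvPolynomial.coe_aeval_eq_eval, RingHom.coe_coe, ← Polynomial.aeval_algHom_apply,
    MvPolynomial.aeval_X, Polynomial.coe_aeval_eq_eval]

lemma aeval_X_ne_zero {m : ℕ} [Infinite k] {π : k[X]} (hπ : π ≠ 0) (i : Fin m) :
    Polynomial.aeval (MvPolynomial.X i : MvPolynomial (Fin m) k) π ≠ 0 := by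
  intro h
  refine hπ (Polynomial.funext fun x ↦ ?_)
  simpa [h] using! (eval_aeval_X π (fun _ ↦ x) i).symm

lemma dilate_injective [Infinite k] {π : k[X]} (hπ : π ≠ 0) :
    Function.Injective (dilate n π) := by
  rw [injective_iff_map_eq_zero]
  intro b hb
  have hdil : ∀ y : Fin (n + 1) → k, MvPolynomial.eval y (dilate n π b) =
      MvPolynomial.eval (Fin.cons (y 0) fun i ↦ π.eval (y 0) * y i.succ) b := by
    intro y
    have : (MvPolynomial.eval y).comp (dilate n π) =
        MvPolynomial.eval (Fin.cons (y 0) fun i ↦ π.eval (y 0) * y i.succ) := by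
      ext i
      · simp [dilate]
      · cases i using Fin.cases with
        | zero => simp [dilate]
        | succ i => simp [dilate, eval_aeval_X]
    exact congrArg (fun φ ↦ φ b) this
  have hmul : b * Polynomial.aeval (MvPolynomial.X 0) π = 0 := by
    refine MvPolynomial.funext fun x ↦ ?_
    rw [map_mul, eval_aeval_X, map_zero]
    by_cases hx : π.eval (x 0) = 0
    · rw [hx, mul_zero]
    · have := hdil (Fin.cons (x 0) fun i ↦ (π.eval (x 0))⁻¹ * x i.succ)
      rw [hb, map_zero] at this
      simp only [Fin.cons_zero, Fin.cons_succ, mul_inv_cancel_left₀ hx] at this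
      rw [show (Fin.cons (x 0) fun i ↦ x i.succ : Fin (n + 1) → k) = x from
        Fin.cons_self_tail x] at this
      rw [← this, zero_mul]
  exact (mul_eq_zero.1 hmul).resolve_right (aeval_X_ne_zero hπ 0)

/-- The generic member of the family of plane sections of an irreducible hypersurface through a
point stays irreducible. -/
theorem isDomain_map_cone [Infinite k] {π : k[X]} (hπ : π ≠ 0)
    {f : (MvPolynomial (Fin (n + 1)) k)[X]} (hf : f.Monic) (hirr : Irreducible f)
    (κ : Type*) [Field κ] [Algebra (MvPolynomial (Fin n) k) κ]
    [IsFractionRing (MvPolynomial (Fin n) k) κ] :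
    IsDomain (AdjoinRoot ((f.map (cone n π)).map
      (mapRingHom (algebraMap (MvPolynomial (Fin n) k) κ)))) := by
  set B := MvPolynomial (Fin (n + 1)) k
  set R := MvPolynomial (Fin n) k
  set L := FractionRing B
  set πL : L := algebraMap B L (Polynomial.aeval (MvPolynomial.X 0) π) with hπL
  have hπL0 : πL ≠ 0 := by
    rw [hπL, Ne, map_eq_zero_iff _ (IsFractionRing.injective B L)]
    exact aeval_X_ne_zero hπ 0
  have hρ : Function.Injective ((algebraMap B L).comp (dilate n π)) :=
    (IsFractionRing.injective B L).comp (dilate_injective hπ)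
  set ρ : L →+* L := IsFractionRing.lift hρ
  have hρB : ∀ b, ρ (algebraMap B L b) = algebraMap B L (dilate n π b) :=
    fun b ↦ IsFractionRing.lift_algebraMap hρ b
  set ψ : R →+* L := eval₂Hom ((algebraMap B L).comp MvPolynomial.C)
    fun i ↦ algebraMap B L (MvPolynomial.X i.succ) / πL with hψ
  have hρπ : ρ πL = πL := by
    rw [hπL, hρB]
    congr 1
    have : (dilate n π).comp (MvPolynomial.C) = MvPolynomial.C := by ext; simp [dilate]
    rw [Polynomial.aeval_def, Polynomial.hom_eval₂, MvPolynomial.algebraMap_eq, this]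
    simp [dilate]
  have hψC : ∀ a : k, ψ (MvPolynomial.C a) = algebraMap B L (MvPolynomial.C a) :=
    fun a ↦ eval₂Hom_C _ _ a
  have hψX : ∀ i, ψ (MvPolynomial.X i) = algebraMap B L (MvPolynomial.X i.succ) / πL :=
    fun i ↦ eval₂Hom_X' _ _ i
  have hdC : ∀ a : k, dilate n π (MvPolynomial.C a) = MvPolynomial.C a :=
    fun a ↦ eval₂Hom_C _ _ a
  have hψinj : Function.Injective ψ := by
    have hcomp : ρ.comp ψ = (algebraMap B L).comp
        (rename Fin.succ : MvPolynomial (Fin n) k →ₐ[k] MvPolynomial (Fin (n + 1)) k).toRingHom := by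
      ext i
      · simp only [RingHom.comp_apply, hψC, hρB, hdC]
        simp
      · simp only [RingHom.comp_apply, hψX, map_div₀, hρπ, hρB]
        simp only [dilate, eval₂Hom_X', Fin.cons_succ, map_mul, ← hπL,
          mul_div_cancel_left₀ _ hπL0]
        simp
    have : Function.Injective (ρ ∘ ψ) := by
      rw [← RingHom.coe_comp, hcomp]
      exact (IsFractionRing.injective B L).comp (rename_injective _ (Fin.succ_injective n))
    exact Function.Injective.of_comp this
  set Ψ : κ[X] →+* L := eval₂RingHom (IsFractionRing.lift hψinj)
    (algebraMap B L (MvPolynomial.X 0)) with hΨ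
  have hΨB : (Ψ.comp (mapRingHom (algebraMap R κ))).comp (cone n π) = algebraMap B L := by
    ext i
    · simp [hΨ, cone, hψC]
    · cases i using Fin.cases with
      | zero => simp [hΨ, cone]
      | succ i =>
        have h1 : (IsFractionRing.lift hψinj).comp ((algebraMap R κ).comp MvPolynomial.C) =
            (algebraMap B L).comp MvPolynomial.C := by
          ext a
          simp [hψC]
        simp only [cone, RingHom.comp_apply, eval₂Hom_X', Fin.cons_succ, map_mul,
          coe_mapRingHom, Polynomial.map_C, Polynomial.map_map, hΨ, coe_eval₂RingHom,
          Polynomial.eval₂_C, Polynomial.eval₂_map, h1, IsFractionRing.lift_algebraMap]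
        rw [← Polynomial.hom_eval₂]
        rw [hψX]
        exact div_mul_cancel₀ _ hπL0
  have hF : ((f.map (cone n π)).map (mapRingHom (algebraMap R κ))).Monic :=
    (hf.map _).map _
  have hL : Irreducible (f.map (algebraMap B L)) :=
    (Polynomial.Monic.irreducible_iff_irreducible_map_fraction_map hf).1 hirr
  have := Polynomial.Monic.irreducible_of_irreducible_map Ψ _ hF (by
    rw [Polynomial.map_map, Polynomial.map_map, hΨB]
    exact hL)
  exact AdjoinRoot.isDomain_of_prime this.prime

end Cone

end MvPolynomial

open Classical in
lemma Finset.sum_le_sum_add_card_filter_mul {ι : Type*} (A : Finset ι) (P : ι → Prop)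
    (φ ψ : ι → ℕ) (D : ℕ) (h : ∀ a ∈ A, φ a ≤ ψ a + if P a then D else 0) :
    ∑ a ∈ A, φ a ≤ ∑ a ∈ A, ψ a + (A.filter P).card * D := by
  refine (Finset.sum_le_sum h).trans ?_
  rw [Finset.sum_add_distrib, Finset.sum_ite]
  simp

namespace MvPolynomial

variable {k : Type*} [Field k] {n : ℕ}

lemma ratRoots_map_eval_le {m : ℕ} {f : (MvPolynomial (Fin m) k)[X]} (hf : f.Monic)
    (b : Fin m → k) (q : ℕ) : ratRoots (f.map (MvPolynomial.eval b)) q ≤ f.natDegree :=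
  (ratRoots_le (hf.map _).ne_zero q).trans natDegree_map_le

lemma sum_ratRoots_cone_of_ne_zero {f : (MvPolynomial (Fin (n + 1)) k)[X]} {q : ℕ}
    (hq : 1 < q) {x c : k} (hc : c ^ q = c) (hc0 : c ≠ 0) :
    ∑ t ∈ ratPoints k n q,
        ratRoots (f.map (MvPolynomial.eval (Fin.cons x fun i ↦ t i * c))) q =
      ∑ y ∈ ratPoints k n q, ratRoots (f.map (MvPolynomial.eval (Fin.cons x y))) q := by
  refine Finset.sum_bij' (fun t _ i ↦ t i * c) (fun y _ i ↦ y i * c⁻¹) ?_ ?_ ?_ ?_ ?_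
  · intro t ht
    rw [mem_ratPoints hq] at ht ⊢
    intro i
    rw [mul_pow, ht, hc]
  · intro t ht
    rw [mem_ratPoints hq] at ht ⊢
    intro i
    rw [mul_pow, ht, inv_pow, hc]
  · intro t _
    funext i
    rw [mul_assoc, mul_inv_cancel₀ hc0, mul_one]
  · intro t _
    funext i
    rw [mul_assoc, inv_mul_cancel₀ hc0, mul_one]
  · intros
    rfl

open Classical in
theorem exists_sum_ratRoots [IsAlgClosed k] (p : ℕ) [Fact p.Prime] [CharP k p]
    {f : (MvPolynomial (Fin (n + 1)) k)[X]} (hf : f.Monic) (hirr : Irreducible f)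
    {u v : (MvPolynomial (Fin (n + 1)) k)[X]} {δ : MvPolynomial (Fin (n + 1)) k}
    (huv : u * f + v * derivative f = Polynomial.C δ) {ξ : k}
    (hδ : MvPolynomial.eval (Fin.cons ξ 0) δ ≠ 0) {π : k[X]} (hπ0 : π ≠ 0)
    (hπξ : π.eval ξ = 0) (hπp : ∀ j, π.coeff j ^ p = π.coeff j) :
    ∃ C K : ℕ, ∀ r s : ℕ, p ^ r ≤ p ^ s → K ≤ p ^ s → 1 < p ^ (r + s) →
      (∀ i d, MvPolynomial.coeff d (f.coeff i) ^ p ^ (r + s) =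
        MvPolynomial.coeff d (f.coeff i)) →
      ∑ b ∈ ratPoints k (n + 1) (p ^ (r + s)),
          ratRoots (f.map (MvPolynomial.eval b)) (p ^ (r + s))
        ≤ (p ^ (r + s)) ^ (n + 1) + C * ((p ^ (r + s)) ^ n * p ^ s) ∧
      (p ^ (r + s)) ^ (n + 1) ≤ ∑ b ∈ ratPoints k (n + 1) (p ^ (r + s)),
          ratRoots (f.map (MvPolynomial.eval b)) (p ^ (r + s)) +
        C * ((p ^ (r + s)) ^ n * p ^ s) := by
  have hd : 0 < f.natDegree := by
    refine Nat.pos_of_ne_zero fun h ↦ hirr.not_isUnit ?_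
    rw [hf.natDegree_eq_zero.1 h]
    exact isUnit_one
  set d := f.natDegree with hd_def
  set F := f.map (cone n π) with hF
  have hFm : F.Monic := hf.map _
  have hFd : F.natDegree = d := hf.natDegree_map _
  obtain ⟨a, ha⟩ : ∃ a, (f.map (MvPolynomial.eval (Fin.cons ξ 0 : Fin (n + 1) → k))).eval a = 0 := by
    refine IsAlgClosed.exists_root _ ?_
    rw [degree_eq_natDegree (hf.map _).ne_zero, hf.natDegree_map]
    exact_mod_cast hd.ne'
  have hcone : ∀ g : (MvPolynomial (Fin (n + 1)) k)[X],
      (g.map (cone n π)).evalEval (MvPolynomial.C ξ) (MvPolynomial.C a) =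
        MvPolynomial.C ((g.map (MvPolynomial.eval (Fin.cons ξ 0 : Fin (n + 1) → k))).eval a) := by
    intro g
    rw [← eval₂_evalRingHom, Polynomial.eval₂_map, evalRingHom_comp_cone π hπξ,
      Polynomial.eval_map, Polynomial.hom_eval₂]
  have ha' : ((derivative f).map
      (MvPolynomial.eval (Fin.cons ξ 0 : Fin (n + 1) → k))).eval a ≠ 0 := by
    intro h
    apply hδ
    have := congrArg (fun g ↦ (g.map
      (MvPolynomial.eval (Fin.cons ξ 0 : Fin (n + 1) → k))).eval a) huv
    simpa [ha, h] using this.symm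
  have hFa : F.evalEval (MvPolynomial.C ξ) (MvPolynomial.C a) = 0 := by
    rw [hF, hcone, ha, MvPolynomial.C_0]
  have hFa' : IsUnit ((derivative F).evalEval (MvPolynomial.C ξ) (MvPolynomial.C a)) := by
    rw [hF, derivative_map, hcone]
    exact (IsUnit.mk0 _ ha').map MvPolynomial.C
  obtain ⟨h, hh0, hh⟩ := PlaneCurve.exists_forall_isDomain
    (K := FractionRing (MvPolynomial (Fin n) k)) hFm (by rw [hFd]; exact hd)
    (isDomain_map_cone hπ0 hf hirr _) _ _ hFa hFa'
  set c := F.support.sup fun i ↦ (F.coeff i).natDegree with hc_def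
  have hc : ∀ i, (F.coeff i).natDegree ≤ c := by
    intro i
    by_cases hi : i ∈ F.support
    · exact Finset.le_sup (f := fun i ↦ (F.coeff i).natDegree) hi
    · simp [Polynomial.notMem_support_iff.1 hi]
  obtain ⟨C₀, K, H⟩ := PlaneCurve.exists_card_rational_points (k := k) p d c hd
  refine ⟨C₀ + d * h.totalDegree + d * π.natDegree, K, ?_⟩
  intro r s hrs hK hq hfix
  set q := p ^ (r + s) with hq_def
  have hpq : p ∣ q := dvd_pow_self p (by rintro h; rw [hq_def, h] at hq; simp at hq)
  set Z : (Fin (n + 1) → k) → ℕ := fun b ↦ ratRoots (f.map (MvPolynomial.eval b)) q with hZ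
  have hZd : ∀ b, Z b ≤ d := fun b ↦ ratRoots_map_eval_le hf b q
  set S := fixedPoints k q with hS
  have hScard : S.card = q := card_fixedPoints hq p hpq
  have hps : 0 < p ^ s := pow_pos (Fact.out : p.Prime).pos s
  set N : (Fin n → k) → ℕ := fun t ↦ ∑ x ∈ S, Z (Fin.cons x fun i ↦ t i * π.eval x) with hN
  have hNd : ∀ t, N t ≤ d * q := fun t ↦ by
    refine (Finset.sum_le_card_nsmul _ _ d fun x _ ↦ hZd _).trans ?_
    rw [hScard, smul_eq_mul, mul_comm]
  -- the count on a good plane section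
  have hgood : ∀ t ∈ ratPoints k n q, MvPolynomial.eval t h ≠ 0 →
      N t ≤ q + C₀ * p ^ s ∧ q ≤ N t + C₀ * p ^ s := by
    intro t ht hth
    rw [mem_ratPoints hq] at ht
    set Ft := F.map (mapRingHom (MvPolynomial.eval t)) with hFt
    have hFtm : Ft.Monic := hFm.map _
    have hFtξ : ∀ G : (MvPolynomial (Fin n) k)[X][X],
        (G.map (mapRingHom (MvPolynomial.eval t))).evalEval ξ a =
          MvPolynomial.eval t (G.evalEval (MvPolynomial.C ξ) (MvPolynomial.C a)) := by
      intro G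
      have := Polynomial.map_mapRingHom_evalEval (MvPolynomial.eval t) G (MvPolynomial.C ξ)
        (MvPolynomial.C a)
      simpa using this
    have hcount := H Ft (hh k (MvPolynomial.eval t) hth) hFtm
      ((hFm.natDegree_map _).trans hFd) (fun i ↦ PlaneCurve.natDegree_coeff_map_le _ hc i)
      ξ a (by rw [hFtξ, hFa, map_zero])
      (by rw [hFt, derivative_map, hFtξ]; exact (hFa'.map _).ne_zero) r s hrs hK hq ?_
    · rw [card_fibrePoints_filter hFtm hq] at hcount
      have : ∑ x ∈ S, ratRoots (Ft.map (evalRingHom x)) q = N t := by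
        refine Finset.sum_congr rfl fun x _ ↦ ?_
        rw [hZ, hFt, hF, Polynomial.map_map, Polynomial.map_map,
          RingHom.comp_assoc, evalRingHom_comp_mapRingHom_comp_cone]
      rwa [this] at hcount
    · intro i j
      have hσ : ∀ y, iterateFrobenius k p (r + s) y = y ^ q := fun y ↦ iterateFrobenius_def p _ y
      have h1 := coeff_mem_of_cone (iterateFrobenius k p (r + s)) (π := π) (t := t)
        (by
          ext j
          rw [Polynomial.coeff_map, hσ, hq_def]
          generalize r + s = m
          induction m with
          | zero => simp
          | succ m ih => rw [pow_succ, pow_mul, ih, hπp])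
        (fun i ↦ by rw [hσ, ht]) (f.coeff i)
        (by
          ext d
          rw [MvPolynomial.coeff_map, hσ, hfix])
      have h2 := congrArg (fun g ↦ Polynomial.coeff g j) h1
      simp only [Polynomial.coeff_map (iterateFrobenius k p (r + s)), hσ] at h2
      simpa [hFt, hF, Polynomial.coeff_map] using h2
  -- summing over the plane sections
  have hcard : (ratPoints k n q).card = q ^ n := card_ratPoints hq p hpq
  have hbad := card_ratPoints_filter_le hq p hpq hh0
  have hsum : ∑ t ∈ ratPoints k n q, N t = ∑ x ∈ S, ∑ t ∈ ratPoints k n q,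
      Z (Fin.cons x fun i ↦ t i * π.eval x) := Finset.sum_comm
  have hconst : ∀ D : ℕ, ∑ _t ∈ ratPoints k n q, D = q ^ n * D := fun D ↦ by
    rw [Finset.sum_const, hcard, smul_eq_mul]
  have hup := Finset.sum_le_sum_add_card_filter_mul (ratPoints k n q)
    (fun t ↦ MvPolynomial.eval t h = 0) N (fun _ ↦ q + C₀ * p ^ s) (d * q) (by
      intro t ht
      by_cases hth : MvPolynomial.eval t h = 0
      · rw [if_pos hth]
        exact (hNd t).trans (Nat.le_add_left _ _)
      · rw [if_neg hth]
        exact (hgood t ht hth).1)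
  have hlow := Finset.sum_le_sum_add_card_filter_mul (ratPoints k n q)
    (fun t ↦ MvPolynomial.eval t h = 0) (fun _ ↦ q) (fun t ↦ N t + C₀ * p ^ s) (d * q) (by
      intro t ht
      by_cases hth : MvPolynomial.eval t h = 0
      · rw [if_pos hth]
        exact (Nat.le_mul_of_pos_left q hd).trans (Nat.le_add_left _ _)
      · rw [if_neg hth]
        exact (hgood t ht hth).2)
  rw [hconst] at hup
  rw [Finset.sum_add_distrib, hconst, hconst] at hlow
  -- comparison of the sections with the whole space
  have hroots : (S.filter fun x ↦ π.eval x = 0).card ≤ π.natDegree := ratRoots_le hπ0 q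
  have hfibre : ∀ x ∈ S,
      (∑ t ∈ ratPoints k n q, Z (Fin.cons x fun i ↦ t i * π.eval x) ≤
        ∑ y ∈ ratPoints k n q, Z (Fin.cons x y) + if π.eval x = 0 then d * q ^ n else 0) ∧
      (∑ y ∈ ratPoints k n q, Z (Fin.cons x y) ≤
        ∑ t ∈ ratPoints k n q, Z (Fin.cons x fun i ↦ t i * π.eval x) +
          if π.eval x = 0 then d * q ^ n else 0) := by
    intro x hx
    have hb : ∀ φ : (Fin n → k) → (Fin (n + 1) → k),
        ∑ t ∈ ratPoints k n q, Z (φ t) ≤ d * q ^ n := fun φ ↦ by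
      refine (Finset.sum_le_card_nsmul _ _ d fun x _ ↦ hZd _).trans ?_
      rw [hcard, smul_eq_mul, mul_comm]
    by_cases hπx : π.eval x = 0
    · rw [if_pos hπx]
      exact ⟨(hb _).trans (Nat.le_add_left _ _), (hb _).trans (Nat.le_add_left _ _)⟩
    · rw [if_neg hπx]
      have hfixπ : (π.eval x) ^ q = π.eval x := by
        have hx' := (mem_fixedPoints hq).1 hx
        have hσ : ∀ y, iterateFrobenius k p (r + s) y = y ^ q :=
          fun y ↦ iterateFrobenius_def p _ y
        rw [← hσ, ← Polynomial.eval₂_at_apply, hσ, hx', ← Polynomial.eval_map]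
        congr 1
        ext j
        rw [Polynomial.coeff_map, hσ, hq_def]
        generalize r + s = m
        induction m with
        | zero => simp
        | succ m ih => rw [pow_succ, pow_mul, ih, hπp]
      have := sum_ratRoots_cone_of_ne_zero (f := f) (x := x) hq hfixπ hπx
      exact ⟨this.le, this.ge⟩
  have hA := Finset.sum_le_sum_add_card_filter_mul S (fun x ↦ π.eval x = 0) _ _ _
    fun x hx ↦ (hfibre x hx).1
  have hB := Finset.sum_le_sum_add_card_filter_mul S (fun x ↦ π.eval x = 0) _ _ _
    fun x hx ↦ (hfibre x hx).2
  rw [← hsum, ← sum_ratPoints_succ hq Z] at hA hB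
  have e1 : (S.filter fun x ↦ π.eval x = 0).card * (d * q ^ n) ≤
      d * π.natDegree * (q ^ n * p ^ s) := by
    calc _ ≤ π.natDegree * (d * q ^ n) := Nat.mul_le_mul_right _ hroots
      _ = d * π.natDegree * (q ^ n * 1) := by ring
      _ ≤ _ := by gcongr; omega
  have e2 : ((ratPoints k n q).filter fun t ↦ MvPolynomial.eval t h = 0).card * (d * q) ≤
      d * h.totalDegree * (q ^ n * p ^ s) := by
    calc _ = d * (((ratPoints k n q).filter fun t ↦ MvPolynomial.eval t h = 0).card * q) := by ring
      _ ≤ d * (h.totalDegree * q ^ n) := Nat.mul_le_mul_left _ hbad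
      _ = d * h.totalDegree * (q ^ n * 1) := by ring
      _ ≤ _ := by gcongr; omega
  constructor
  · nlinarith [pow_succ q n]
  · nlinarith [pow_succ q n]

end MvPolynomial

namespace MvPolynomial

section Derivatives

variable {k : Type*} [Field k]

lemma derivative_finSuccEquiv {n : ℕ} (g : MvPolynomial (Fin (n + 1)) k) :
    derivative (finSuccEquiv k n g) = finSuccEquiv k n (pderiv 0 g) := by
  ext i m
  have h : Finsupp.cons i m + Finsupp.single 0 1 = Finsupp.cons (i + 1) m := by
    ext j
    cases j using Fin.cases <;> simp
  rw [Polynomial.coeff_derivative, finSuccEquiv_coeff_coeff, coeff_pderiv, h, Finsupp.cons_zero,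
    show ((i : MvPolynomial (Fin n) k) + 1) = MvPolynomial.C ((i : k) + 1) by simp,
    mul_comm, MvPolynomial.coeff_C_mul, finSuccEquiv_coeff_coeff, mul_comm]

lemma pderiv_zero_shear {n : ℕ} (p : ℕ) [CharP k p] {u : ℕ} (hu : p ∣ u)
    (g : MvPolynomial (Fin (n + 1)) k) :
    pderiv 0 (shear k n u g) = shear k n u (pderiv 0 g) := by
  have hC : ∀ a, shear k n u (MvPolynomial.C a) = MvPolynomial.C a := (shear k n u).commutes
  have hX : ∀ i, pderiv 0 (shear k n u (MvPolynomial.X i)) =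
      shear k n u (pderiv 0 (MvPolynomial.X i)) := by
    intro i
    rw [shear_X]
    split_ifs with hi
    · simp [hi]
    · have hpow : ((u ^ (i : ℕ) : ℕ) : MvPolynomial (Fin (n + 1)) k) = 0 := by
        rw [CharP.cast_eq_zero_iff _ p]
        exact hu.trans (dvd_pow_self u (fun h ↦ hi (Fin.ext h)))
      rw [map_add, pderiv_X_of_ne hi, pderiv_pow, hpow]
      simp
  induction g using MvPolynomial.induction_on with
  | C a => simp [hC]
  | add f g hf hg => simp only [map_add, hf, hg]
  | mul_X f i hf => rw [map_mul, pderiv_mul, pderiv_mul, hf, hX, map_add, map_mul, map_mul]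

/-- Over an algebraically closed field an irreducible polynomial has a nonvanishing partial
derivative. -/
theorem exists_pderiv_ne_zero [IsAlgClosed k] (p : ℕ) [Fact p.Prime] [CharP k p] {σ : Type*}
    {g : MvPolynomial σ k} (hg : Irreducible g) : ∃ i, pderiv i g ≠ 0 := by
  by_contra! h
  have hp : p ≠ 0 := (Fact.out : p.Prime).ne_zero
  have hdvd : ∀ v ∈ g.support, ∀ i, p ∣ v i := by
    intro v hv i
    by_cases hvi : v i = 0
    · simp [hvi]
    have h1 := congrArg (MvPolynomial.coeff (v - Finsupp.single i 1)) (h i)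
    have h2 : v - Finsupp.single i 1 + Finsupp.single i 1 = v := by
      ext j
      by_cases hj : i = j
      · subst hj
        simp
        omega
      · simp [hj]
    rw [coeff_pderiv, h2, MvPolynomial.coeff_zero] at h1
    have h3 := (mul_eq_zero.1 h1).resolve_left (mem_support_iff.1 hv)
    have h4 : ((v i : ℕ) : k) = 0 := by
      rw [← h3]
      simp only [Finsupp.coe_tsub, Pi.sub_apply, Finsupp.single_eq_same]
      rw [← Nat.cast_add_one]
      congr 1
      omega
    exact (CharP.cast_eq_zero_iff k p _).1 h4
  choose! root hroot using fun a : k ↦ IsAlgClosed.exists_pow_nat_eq a (Nat.pos_of_ne_zero hp)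
  set f : MvPolynomial σ k := ∑ v ∈ g.support,
    monomial (v.mapRange (· / p) (Nat.zero_div p)) (root (MvPolynomial.coeff v g)) with hf
  have : f ^ p = g := by
    rw [hf, sum_pow_char]
    conv_rhs => rw [← g.support_sum_monomial_coeff]
    refine Finset.sum_congr rfl fun v hv ↦ ?_
    have hv' : p • v.mapRange (· / p) (Nat.zero_div p) = v := by
      ext i
      exact Nat.mul_div_cancel' (hdvd v hv i)
    rw [monomial_pow, hroot, hv']
  rw [← this] at hg
  exact not_irreducible_pow (Fact.out : p.Prime).ne_one hg

end Derivatives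

end MvPolynomial

/-- A monic irreducible polynomial over a normal domain and a polynomial it does not divide
generate an ideal containing a nonzero constant. -/
theorem Polynomial.Monic.exists_mul_add_mul_eq_C {B : Type*} [CommRing B] [IsDomain B]
    [IsIntegrallyClosed B] {f g : B[X]} (hf : f.Monic) (hirr : Irreducible f) (hfg : ¬ f ∣ g) :
    ∃ (u v : B[X]) (δ : B), δ ≠ 0 ∧ u * f + v * g = Polynomial.C δ := by
  set L := FractionRing B
  have hinj : Function.Injective (algebraMap B L) := IsFractionRing.injective B L
  have hL : Irreducible (f.map (algebraMap B L)) :=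
    (hf.irreducible_iff_irreducible_map_fraction_map).1 hirr
  obtain ⟨a, b, hab⟩ := (hL.coprime_iff_not_dvd).2 fun h ↦
    hfg ((Polynomial.map_dvd_map _ hinj hf).1 h)
  obtain ⟨c, hc, hca⟩ := IsLocalization.integerNormalization_spec (nonZeroDivisors B) a
  obtain ⟨e, he, heb⟩ := IsLocalization.integerNormalization_spec (nonZeroDivisors B) b
  set a' := IsLocalization.integerNormalization (nonZeroDivisors B) a
  set b' := IsLocalization.integerNormalization (nonZeroDivisors B) b
  refine ⟨Polynomial.C e * a', Polynomial.C c * b', c * e,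
    mul_ne_zero (nonZeroDivisors.ne_zero hc) (nonZeroDivisors.ne_zero he), ?_⟩
  apply Polynomial.map_injective _ hinj
  simp only [Polynomial.map_add, Polynomial.map_mul, Polynomial.map_C, map_mul]
  have hca' : a'.map (algebraMap B L) = Polynomial.C (algebraMap B L c) * a := by
    rw [hca]
    ext i
    simp [Algebra.smul_def]
  have heb' : b'.map (algebraMap B L) = Polynomial.C (algebraMap B L e) * b := by
    rw [heb]
    ext i
    simp [Algebra.smul_def]
  rw [hca', heb']
  linear_combination (Polynomial.C (algebraMap B L c) * Polynomial.C (algebraMap B L e)) * hab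

section Counting

variable {k : Type*} [Field k] {n : ℕ}

lemma sum_ratPoints_shearPoint (p : ℕ) [Fact p.Prime] [CharP k p] {N : ℕ} (hN : 1 < p ^ N)
    {M : Type*} [AddCommMonoid M] (u : ℕ) (φ : (Fin (n + 1) → k) → M) :
    ∑ b ∈ ratPoints k (n + 1) (p ^ N), φ (shearPoint u b) =
      ∑ b ∈ ratPoints k (n + 1) (p ^ N), φ b := by
  have hσ : ∀ y, y ^ p ^ N = iterateFrobenius k p N y := fun y ↦ (iterateFrobenius_def p _ y).symm
  have hbij := shearPoint_bijOn (n := n) (S := {a : k | a ^ p ^ N = a})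
    (fun a ha b hb ↦ by
      simp only [hσ, Set.mem_ofPred_eq] at *
      rw [map_add, ha, hb])
    (fun a ha ↦ by
      simp only [hσ, Set.mem_ofPred_eq] at *
      rw [map_neg, ha])
    (fun a ha m ↦ by
      simp only [hσ, Set.mem_ofPred_eq] at *
      rw [map_pow, ha]) u
  have hmem : ∀ x : Fin (n + 1) → k, x ∈ ratPoints k (n + 1) (p ^ N) ↔
      x ∈ {x : Fin (n + 1) → k | ∀ i, x i ∈ {a : k | a ^ p ^ N = a}} :=
    fun x ↦ mem_ratPoints hN
  refine Finset.sum_bij (fun b _ ↦ shearPoint u b) ?_ ?_ ?_ ?_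
  · intro b hb
    exact (hmem _).2 (hbij.mapsTo ((hmem _).1 hb))
  · intro a ha b hb h
    exact hbij.injOn ((hmem _).1 ha) ((hmem _).1 hb) h
  · intro b hb
    obtain ⟨a, ha, rfl⟩ := hbij.surjOn ((hmem _).1 hb)
    exact ⟨a, (hmem _).2 ha, rfl⟩
  · intros
    rfl

/-- A shear, followed by a normalization, makes a polynomial monic in the first variable. -/
theorem exists_monic_shear {g : MvPolynomial (Fin (n + 1)) k} (hg : g ≠ 0) {u : ℕ}
    (hu : 1 < u) (hgu : g.totalDegree < u) :
    ∃ c : k, c ≠ 0 ∧ (∃ v, MvPolynomial.coeff v g = c) ∧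
      (Polynomial.C (MvPolynomial.C c⁻¹) * finSuccEquiv k n (shear k n u g)).Monic := by
  obtain ⟨v, hv, hlc⟩ := exists_leadingCoeff_shear hg hu hgu
  have hc := mem_support_iff.1 hv
  refine ⟨_, hc, ⟨v, rfl⟩, ?_⟩
  rw [Monic, leadingCoeff_mul, hlc, leadingCoeff_C, ← MvPolynomial.C_mul, inv_mul_cancel₀ hc,
    MvPolynomial.C_1]

lemma eval_monic_shear (g : MvPolynomial (Fin (n + 1)) k) (u : ℕ) (c y : k) (x : Fin n → k) :
    ((Polynomial.C (MvPolynomial.C c⁻¹) * finSuccEquiv k n (shear k n u g)).map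
      (MvPolynomial.eval x)).eval y =
      c⁻¹ * MvPolynomial.eval (shearPoint u (Fin.cons y x)) g := by
  rw [← eval_shear, eval_eq_eval_mv_eval']
  simp

lemma irreducible_monic_shear {g : MvPolynomial (Fin (n + 1)) k} (hg : Irreducible g) (u : ℕ)
    {c : k} (hc : c ≠ 0) :
    Irreducible (Polynomial.C (MvPolynomial.C c⁻¹) * finSuccEquiv k n (shear k n u g)) := by
  have hu : IsUnit (Polynomial.C (MvPolynomial.C c⁻¹ : MvPolynomial (Fin n) k)) :=
    ((IsUnit.mk0 _ (inv_ne_zero hc)).map MvPolynomial.C).map Polynomial.C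
  rw [irreducible_isUnit_mul hu, MulEquiv.irreducible_iff, MulEquiv.irreducible_iff]
  exact hg

open Classical in
lemma card_zeros_eq_sum_ratRoots (p : ℕ) [Fact p.Prime] [CharP k p] {N : ℕ} (hN : 1 < p ^ N)
    (g : MvPolynomial (Fin (n + 1)) k) (u : ℕ) {c : k} (hc : c ≠ 0) :
    ((ratPoints k (n + 1) (p ^ N)).filter fun x ↦ MvPolynomial.eval x g = 0).card =
      ∑ b ∈ ratPoints k n (p ^ N), ratRoots ((Polynomial.C (MvPolynomial.C c⁻¹) *
        finSuccEquiv k n (shear k n u g)).map (MvPolynomial.eval b)) (p ^ N) := by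
  rw [Finset.card_filter, ← sum_ratPoints_shearPoint p hN u, sum_ratPoints_succ hN]
  refine Finset.sum_comm.trans (Finset.sum_congr rfl fun b _ ↦ ?_)
  rw [ratRoots, Finset.card_filter]
  simp only [eval_monic_shear, mul_eq_zero, inv_eq_zero, hc, false_or]

open Classical in
lemma card_filter_ratPoints_comp_equiv {q : ℕ} (hq : 1 < q) (e : Fin n ≃ Fin n)
    (P : (Fin n → k) → Prop) :
    ((ratPoints k n q).filter fun x ↦ P (x ∘ e)).card = ((ratPoints k n q).filter P).card := by
  refine Finset.card_bij (fun x _ ↦ x ∘ e) ?_ ?_ ?_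
  · intro x hx
    rw [Finset.mem_filter, mem_ratPoints hq] at hx ⊢
    exact ⟨fun i ↦ hx.1 _, hx.2⟩
  · intro x _ y _ h
    exact e.surjective.injective_comp_right h
  · intro x hx
    rw [Finset.mem_filter, mem_ratPoints hq] at hx
    refine ⟨x ∘ e.symm, ?_, ?_⟩
    · rw [Finset.mem_filter, mem_ratPoints hq]
      refine ⟨fun i ↦ hx.1 _, ?_⟩
      rw [Function.comp_assoc, Equiv.symm_comp_self]
      exact hx.2
    · rw [Function.comp_assoc, Equiv.symm_comp_self]
      rfl

open Classical in
/-- The common zeros of an irreducible polynomial and a polynomial which it does not divide lie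
on a set of codimension two. -/
theorem exists_card_common_zeros_le [IsAlgClosed k] (p : ℕ) [Fact p.Prime] [CharP k p]
    {g h : MvPolynomial (Fin (n + 1)) k} (hg : Irreducible g) (hgh : ¬ g ∣ h) :
    ∃ C : ℕ, ∀ N : ℕ, 1 < p ^ N →
      ((ratPoints k (n + 1) (p ^ N)).filter fun x ↦
        MvPolynomial.eval x g = 0 ∧ MvPolynomial.eval x h = 0).card * p ^ N
          ≤ C * (p ^ N) ^ n := by
  set u := g.totalDegree + 2 with hu
  obtain ⟨c, hc, -, hm⟩ := exists_monic_shear hg.ne_zero (u := u) (by omega) (by omega)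
  set f := Polynomial.C (MvPolynomial.C c⁻¹) * finSuccEquiv k n (shear k n u g) with hf
  set h' := finSuccEquiv k n (shear k n u h) with hh'
  have hirr : Irreducible f := irreducible_monic_shear hg u hc
  have hunit : IsUnit (Polynomial.C (MvPolynomial.C c⁻¹ : MvPolynomial (Fin n) k)) :=
    ((IsUnit.mk0 _ (inv_ne_zero hc)).map MvPolynomial.C).map Polynomial.C
  have hfh : ¬ f ∣ h' := by
    rw [hf, hunit.mul_left_dvd, hh', map_dvd_iff, map_dvd_iff]
    exact hgh
  obtain ⟨v, w, δ, hδ, huv⟩ := hm.exists_mul_add_mul_eq_C hirr hfh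
  refine ⟨f.natDegree * δ.totalDegree, fun N hN ↦ ?_⟩
  have hN0 : N ≠ 0 := by rintro rfl; simp at hN
  have hbad := card_ratPoints_filter_le hN p (dvd_pow_self p hN0) hδ
  have key : ((ratPoints k (n + 1) (p ^ N)).filter fun x ↦
        MvPolynomial.eval x g = 0 ∧ MvPolynomial.eval x h = 0).card ≤
      0 + ((ratPoints k n (p ^ N)).filter fun b ↦ MvPolynomial.eval b δ = 0).card *
        f.natDegree := by
    rw [Finset.card_filter, ← sum_ratPoints_shearPoint p hN u, sum_ratPoints_succ hN,
      Finset.sum_comm]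
    refine (Finset.sum_le_sum_add_card_filter_mul _ (fun b ↦ MvPolynomial.eval b δ = 0) _
      (fun _ ↦ 0) f.natDegree fun b hb ↦ ?_).trans (by simp)
    have hroot : ∀ z, MvPolynomial.eval (shearPoint u (Fin.cons z b)) g = 0 →
        (f.map (MvPolynomial.eval b)).eval z = 0 := fun z hz ↦ by
      rw [hf, eval_monic_shear, hz, mul_zero]
    split_ifs with hδb
    · rw [zero_add]
      refine le_trans ?_ (ratRoots_map_eval_le hm b (p ^ N))
      rw [ratRoots, Finset.card_filter]
      refine Finset.sum_le_sum fun z _ ↦ ?_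
      by_cases hz : MvPolynomial.eval (shearPoint u (Fin.cons z b)) g = 0
      · rw [if_pos (hroot z hz)]
        split_ifs <;> simp
      · simp [hz]
    · refine le_of_eq (Finset.sum_eq_zero fun z _ ↦ if_neg ?_)
      rintro ⟨h1, h2⟩
      apply hδb
      have := congrArg (fun F ↦ (F.map (MvPolynomial.eval b)).eval z) huv
      have h3 : (h'.map (MvPolynomial.eval b)).eval z = 0 := by
        rw [hh', ← eval_eq_eval_mv_eval', eval_shear, h2]
      simpa [hroot z h1, h3] using this.symm
  calc _ ≤ (0 + ((ratPoints k n (p ^ N)).filter fun b ↦ MvPolynomial.eval b δ = 0).card *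
        f.natDegree) * p ^ N := Nat.mul_le_mul_right _ key
    _ = f.natDegree * (((ratPoints k n (p ^ N)).filter fun b ↦
        MvPolynomial.eval b δ = 0).card * p ^ N) := by ring
    _ ≤ f.natDegree * (δ.totalDegree * (p ^ N) ^ n) := Nat.mul_le_mul_left _ hbad
    _ = _ := by ring

end Counting

section Hypersurface

variable {k : Type*} [Field k] {n : ℕ}

lemma exists_polynomial_pow_coeff (p : ℕ) [Fact p.Prime] [Algebra (ZMod p) k]
    [Algebra.IsAlgebraic (ZMod p) k] (ξ : k) :
    ∃ π : k[X], π ≠ 0 ∧ π.eval ξ = 0 ∧ ∀ j, π.coeff j ^ p = π.coeff j := by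
  have hξ : IsIntegral (ZMod p) ξ := Algebra.IsIntegral.isIntegral ξ
  refine ⟨(minpoly (ZMod p) ξ).map (algebraMap (ZMod p) k),
    ((minpoly.monic hξ).map _).ne_zero, ?_, fun j ↦ ?_⟩
  · rw [Polynomial.eval_map_algebraMap, minpoly.aeval]
  · rw [Polynomial.coeff_map, ← map_pow, ZMod.pow_card]

lemma map_coeff_finSuccEquiv (σ : k →+* k) (g : MvPolynomial (Fin (n + 1)) k) (i : ℕ) :
    MvPolynomial.map σ ((finSuccEquiv k n g).coeff i) =
      (finSuccEquiv k n (MvPolynomial.map σ g)).coeff i := by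
  ext m
  rw [MvPolynomial.coeff_map, finSuccEquiv_coeff_coeff, finSuccEquiv_coeff_coeff,
    MvPolynomial.coeff_map]

lemma exists_eval_cons_zero_ne_zero [Infinite k] {δ : MvPolynomial (Fin (n + 1)) k}
    (hδ : δ ≠ 0) {u : ℕ} (hu : 1 < u) (hδu : δ.totalDegree < u) :
    ∃ ξ, MvPolynomial.eval (Fin.cons ξ 0) (shear k n u δ) ≠ 0 := by
  obtain ⟨c, hc, -, hm⟩ := exists_monic_shear hδ hu hδu
  by_contra! h
  refine (hm.map (MvPolynomial.eval (0 : Fin n → k))).ne_zero (Polynomial.funext fun ξ ↦ ?_)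
  rw [eval_monic_shear, ← eval_shear, h, mul_zero, Polynomial.eval_zero]

open Classical in
/-- The Lang–Weil estimate for an absolutely irreducible hypersurface in affine space. -/
theorem exists_card_zeros_of_irreducible [IsAlgClosed k] (p : ℕ) [Fact p.Prime] [CharP k p]
    [Algebra (ZMod p) k] [Algebra.IsAlgebraic (ZMod p) k]
    {g : MvPolynomial (Fin (n + 2)) k} (hg : Irreducible g) :
    ∃ C K : ℕ, ∀ r s : ℕ, p ^ r ≤ p ^ s → K ≤ p ^ s → 1 < p ^ (r + s) →
      (∀ d, MvPolynomial.coeff d g ^ p ^ (r + s) = MvPolynomial.coeff d g) →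
      ((ratPoints k (n + 2) (p ^ (r + s))).filter fun x ↦ MvPolynomial.eval x g = 0).card
        ≤ (p ^ (r + s)) ^ (n + 1) + C * ((p ^ (r + s)) ^ n * p ^ s) ∧
      (p ^ (r + s)) ^ (n + 1) ≤
        ((ratPoints k (n + 2) (p ^ (r + s))).filter fun x ↦ MvPolynomial.eval x g = 0).card +
        C * ((p ^ (r + s)) ^ n * p ^ s) := by
  have hp : 1 < p := (Fact.out : p.Prime).one_lt
  obtain ⟨i₀, hi₀⟩ := exists_pderiv_ne_zero p hg
  set e := Equiv.swap 0 i₀ with he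
  set g₁ := rename e g with hg₁
  have hg₁irr : Irreducible g₁ := (MulEquiv.irreducible_iff (renameEquiv k e)).2 hg
  have hg₁der : pderiv 0 g₁ ≠ 0 := by
    have h := pderiv_rename e.injective i₀ g
    rw [he, Equiv.swap_apply_right] at h
    rw [hg₁, he, h]
    exact (map_ne_zero_iff _ (rename_injective _ e.injective)).2 hi₀
  set u := p * (g₁.totalDegree + 2) with hu
  have hu' : g₁.totalDegree + 2 ≤ u := Nat.le_mul_of_pos_left _ (by omega)
  obtain ⟨c, hc, ⟨v₀, hv₀⟩, hm⟩ :=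
    exists_monic_shear hg₁irr.ne_zero (u := u) (by omega) (by omega)
  set f := Polynomial.C (MvPolynomial.C c⁻¹) * finSuccEquiv k (n + 1) (shear k (n + 1) u g₁)
    with hf
  have hirr : Irreducible f := irreducible_monic_shear hg₁irr u hc
  have hder : derivative f ≠ 0 := by
    rw [hf, derivative_C_mul, derivative_finSuccEquiv,
      pderiv_zero_shear p (Dvd.intro _ rfl)]
    simp [hc, hg₁der]
  have hdvd : ¬ f ∣ derivative f := fun h ↦
    (natDegree_derivative_lt (fun h0 ↦ hder (derivative_of_natDegree_zero h0))).not_ge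
      (natDegree_le_of_dvd h hder)
  obtain ⟨v, w, δ, hδ, hvw⟩ := hm.exists_mul_add_mul_eq_C hirr hdvd
  set u' := δ.totalDegree + 2 with hu'
  obtain ⟨ξ, hξ⟩ := exists_eval_cons_zero_ne_zero hδ (u := u') (by omega) (by omega)
  obtain ⟨π, hπ0, hπξ, hπp⟩ := exists_polynomial_pow_coeff p ξ
  set τ : MvPolynomial (Fin (n + 1)) k ≃+* MvPolynomial (Fin (n + 1)) k :=
    (shear k n u').toRingEquiv with hτ
  set f' := f.map τ.toRingHom with hf'
  have hf'irr : Irreducible f' := (MulEquiv.irreducible_iff (Polynomial.mapEquiv τ)).2 hirr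
  have hvw' : v.map τ.toRingHom * f' + w.map τ.toRingHom * derivative f' =
      Polynomial.C (shear k n u' δ) := by
    have := congrArg (Polynomial.map τ.toRingHom) hvw
    rwa [Polynomial.map_add, Polynomial.map_mul (f := τ.toRingHom) (p := v),
      Polynomial.map_mul (f := τ.toRingHom) (p := w), Polynomial.map_C, ← derivative_map] at this
  obtain ⟨C, K, H⟩ := exists_sum_ratRoots p (hm.map _) hf'irr hvw' hξ hπ0 hπξ hπp
  refine ⟨C, K, fun r s hrs hK hq hfix ↦ ?_⟩
  have hσ : ∀ y, iterateFrobenius k p (r + s) y = y ^ p ^ (r + s) :=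
    fun y ↦ iterateFrobenius_def p _ y
  have hcount := H r s hrs hK hq ?_
  · have hsum : ((ratPoints k (n + 2) (p ^ (r + s))).filter
        fun x ↦ MvPolynomial.eval x g = 0).card =
        ∑ b ∈ ratPoints k (n + 1) (p ^ (r + s)),
          ratRoots (f'.map (MvPolynomial.eval b)) (p ^ (r + s)) := by
      rw [← card_filter_ratPoints_comp_equiv hq e]
      have h1 : ∀ x : Fin (n + 2) → k, MvPolynomial.eval (x ∘ e) g = MvPolynomial.eval x g₁ :=
        fun x ↦ (eval_rename _ _ _).symm
      simp only [h1]
      rw [card_zeros_eq_sum_ratRoots p hq g₁ u hc, ← sum_ratPoints_shearPoint p hq u']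
      refine Finset.sum_congr rfl fun b _ ↦ ?_
      rw [hf', Polynomial.map_map]
      congr 2
      exact RingHom.ext fun x ↦ (eval_shear u' b x).symm
    rwa [hsum]
  · intro i d
    have hg₁σ : MvPolynomial.map (iterateFrobenius k p (r + s)) g₁ = g₁ := by
      rw [hg₁, map_rename]
      congr 1
      ext d
      rw [MvPolynomial.coeff_map, hσ, hfix]
    have hcσ : iterateFrobenius k p (r + s) c = c := by
      rw [← hv₀, ← MvPolynomial.coeff_map, hg₁σ]
    have h : MvPolynomial.map (iterateFrobenius k p (r + s)) (f'.coeff i) = f'.coeff i := by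
      have h1 : f'.coeff i = shear k n u' (f.coeff i) := Polynomial.coeff_map _ _
      rw [h1, map_shear, hf, Polynomial.coeff_C_mul, map_mul, map_coeff_finSuccEquiv,
        map_shear, hg₁σ, MvPolynomial.map_C, map_inv₀, hcσ]
    rw [← hσ, ← MvPolynomial.coeff_map, h]

end Hypersurface

section Assembly

open Classical in
/-- The Lang–Weil estimate for the zeros of a finite set of pairwise coprime absolutely
irreducible polynomials, outside another hypersurface. -/
theorem exists_card_zeros_of_finset {k : Type*} [Field k] {n : ℕ} [IsAlgClosed k] (p : ℕ)
    [Fact p.Prime] [CharP k p] [Algebra (ZMod p) k] [Algebra.IsAlgebraic (ZMod p) k]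
    (G : Finset (MvPolynomial (Fin (n + 2)) k)) (hG : ∀ g ∈ G, Irreducible g)
    (hGG : ∀ g ∈ G, ∀ g' ∈ G, g ∣ g' → g = g') (h : MvPolynomial (Fin (n + 2)) k)
    (hGh : ∀ g ∈ G, ¬ g ∣ h) :
    ∃ C K : ℕ, ∀ r s : ℕ, p ^ r ≤ p ^ s → K ≤ p ^ s → 1 < p ^ (r + s) →
      (∀ g ∈ G, ∀ d, MvPolynomial.coeff d g ^ p ^ (r + s) = MvPolynomial.coeff d g) →
      ((ratPoints k (n + 2) (p ^ (r + s))).filter fun x ↦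
        (∃ g ∈ G, MvPolynomial.eval x g = 0) ∧ MvPolynomial.eval x h ≠ 0).card
        ≤ G.card * (p ^ (r + s)) ^ (n + 1) + C * ((p ^ (r + s)) ^ n * p ^ s) ∧
      G.card * (p ^ (r + s)) ^ (n + 1) ≤
        ((ratPoints k (n + 2) (p ^ (r + s))).filter fun x ↦
          (∃ g ∈ G, MvPolynomial.eval x g = 0) ∧ MvPolynomial.eval x h ≠ 0).card +
        C * ((p ^ (r + s)) ^ n * p ^ s) := by
  have hp : 0 < p := (Fact.out : p.Prime).pos
  have h1 : ∀ g ∈ G, _ := fun g hg ↦ exists_card_zeros_of_irreducible p (hG g hg)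
  choose! C K H using h1
  have h2 : ∀ g ∈ G, ¬ g ∣ h * ∏ g' ∈ G.erase g, g' := by
    intro g hg hdvd
    have hprime := (hG g hg).prime
    rcases hprime.dvd_or_dvd hdvd with hd | hd
    · exact hGh g hg hd
    · obtain ⟨g', hg', hd⟩ := (hprime.dvd_finsetProd_iff _).1 hd
      exact (Finset.mem_erase.1 hg').1 (hGG g hg g' (Finset.mem_erase.1 hg').2 hd).symm
  have h3 : ∀ g ∈ G, _ := fun g hg ↦ exists_card_common_zeros_le p (hG g hg) (h2 g hg)
  choose! D HD using h3
  refine ⟨∑ g ∈ G, (C g + D g), ∑ g ∈ G, K g, fun r s hrs hK hq hfix ↦ ?_⟩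
  have hKg : ∀ g ∈ G, K g ≤ p ^ s := fun g hg ↦
    (Finset.single_le_sum (f := K) (fun _ _ ↦ Nat.zero_le _) hg).trans hK
  set q := p ^ (r + s) with hqdef
  set R := ratPoints k (n + 2) q with hR
  set N := R.filter fun x ↦ (∃ g ∈ G, MvPolynomial.eval x g = 0) ∧ MvPolynomial.eval x h ≠ 0
    with hN
  have hs : 1 ≤ p ^ s := Nat.one_le_pow _ _ hp
  have hD : ∀ g ∈ G, (R.filter fun x ↦ MvPolynomial.eval x g = 0 ∧
      MvPolynomial.eval x (h * ∏ g' ∈ G.erase g, g') = 0).card ≤ D g * (q ^ n * p ^ s) := by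
    intro g hg
    have h4 := HD g hg (r + s) hq
    rw [← hqdef, pow_succ, ← mul_assoc] at h4
    calc _ ≤ D g * q ^ n := Nat.le_of_mul_le_mul_right h4 (by omega)
      _ ≤ _ := by
        rw [← mul_assoc]
        exact Nat.le_mul_of_pos_right _ hs
  have hbasic : ∀ a : ℕ, G.card * a = ∑ _g ∈ G, a := fun a ↦ by simp
  constructor
  · have hsub : N ⊆ G.biUnion fun g ↦ R.filter fun x ↦ MvPolynomial.eval x g = 0 := by
      intro x hx
      obtain ⟨hx, ⟨g, hg, hgx⟩, -⟩ := Finset.mem_filter.1 hx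
      exact Finset.mem_biUnion.2 ⟨g, hg, Finset.mem_filter.2 ⟨hx, hgx⟩⟩
    refine (Finset.card_le_card hsub).trans (Finset.card_biUnion_le.trans ?_)
    rw [hbasic, Finset.sum_mul, ← Finset.sum_add_distrib]
    refine Finset.sum_le_sum fun g hg ↦ ((H g hg r s hrs (hKg g hg) hq (hfix g hg)).1).trans ?_
    gcongr
    exact Nat.le_add_right _ _
  · have hsub : (G.biUnion fun g ↦ R.filter fun x ↦ MvPolynomial.eval x g = 0 ∧
        ¬ MvPolynomial.eval x (h * ∏ g' ∈ G.erase g, g') = 0) ⊆ N := by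
      intro x hx
      obtain ⟨g, hg, hx⟩ := Finset.mem_biUnion.1 hx
      obtain ⟨hx, hgx, hhx⟩ := Finset.mem_filter.1 hx
      rw [map_mul] at hhx
      exact Finset.mem_filter.2 ⟨hx, ⟨g, hg, hgx⟩, left_ne_zero_of_mul hhx⟩
    have hcard := Finset.card_le_card hsub
    rw [Finset.card_biUnion] at hcard
    · refine le_trans ?_ (Nat.add_le_add_right hcard _)
      rw [hbasic, Finset.sum_mul, ← Finset.sum_add_distrib]
      refine Finset.sum_le_sum fun g hg ↦
        ((H g hg r s hrs (hKg g hg) hq (hfix g hg)).2).trans ?_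
      rw [← hqdef, ← hR]
      have hsplit := Finset.card_filter_add_card_filter_not
        (s := R.filter fun x ↦ MvPolynomial.eval x g = 0)
        (fun x ↦ MvPolynomial.eval x (h * ∏ g' ∈ G.erase g, g') = 0)
      rw [Finset.filter_filter, Finset.filter_filter] at hsplit
      have h5 := hD g hg
      rw [add_mul]
      omega
    · intro g hg g' hg' hne
      refine Finset.disjoint_left.2 fun x hx hx' ↦ (Finset.mem_filter.1 hx).2.2 ?_
      rw [map_mul, map_prod, Finset.prod_eq_zero (Finset.mem_erase.2 ⟨hne.symm, hg'⟩)
        (Finset.mem_filter.1 hx').2.1, mul_zero]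

section BaseChange

variable {σ F L : Type*} [Field F] [Field L] [Algebra F L]

/-- Coprime polynomials stay coprime after an extension of the field of coefficients. -/
lemma IsRelPrime.map_algebraMap [Finite σ] {f h : MvPolynomial σ F} (hfh : IsRelPrime f h)
    (hf : f ≠ 0) :
    IsRelPrime (MvPolynomial.map (algebraMap F L) f) (MvPolynomial.map (algebraMap F L) h) := by
  rintro g ⟨f', hf'⟩ ⟨h', hh'⟩
  have hf0 : MvPolynomial.map (algebraMap F L) f ≠ 0 :=
    (map_ne_zero_iff _ (map_injective _ (algebraMap F L).injective)).2 hf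
  have hg0 : g ≠ 0 := by rintro rfl; exact hf0 (by rw [hf', zero_mul])
  have hf'0 : f' ≠ 0 := by rintro rfl; exact hf0 (by rw [hf', mul_zero])
  have hcross : MvPolynomial.map (algebraMap F L) h * f' =
      MvPolynomial.map (algebraMap F L) f * h' := by rw [hf', hh']; ring
  by_contra hu
  have hdegf : (MvPolynomial.map (algebraMap F L) f).totalDegree = f.totalDegree := by
    rw [totalDegree, totalDegree, MvPolynomial.support_map_of_injective _ (algebraMap F L).injective]
  have hdeg : f'.totalDegree < f.totalDegree := by
    have h1 := congrArg MvPolynomial.totalDegree hf'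
    rw [totalDegree_mul_of_isDomain hg0 hf'0,
      hdegf] at h1
    have h2 : g.totalDegree ≠ 0 := fun h0 ↦ by
      rw [totalDegree_eq_zero_iff_eq_C] at h0
      rw [h0] at hu hg0
      exact hu ((isUnit_iff_ne_zero.2 fun h ↦ hg0 (by rw [h, map_zero])).map MvPolynomial.C)
    omega
  -- apply an `F`-linear functional to the coefficients
  have hlin : ∀ (φ : L →ₗ[F] F) (P : MvPolynomial σ L), ∃ Q : MvPolynomial σ F,
      (∀ d, MvPolynomial.coeff d Q = φ (MvPolynomial.coeff d P)) := fun φ P ↦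
    ⟨∑ d ∈ P.support, monomial d (φ (MvPolynomial.coeff d P)), fun d ↦ by
      classical
      simp only [MvPolynomial.coeff_sum, MvPolynomial.coeff_monomial, Finset.sum_ite_eq']
      split_ifs with hd
      · rfl
      · rw [notMem_support_iff.1 hd, map_zero]⟩
  have hmul : ∀ (φ : L →ₗ[F] F) (a : MvPolynomial σ F) (P : MvPolynomial σ L)
      (Q : MvPolynomial σ F), (∀ d, MvPolynomial.coeff d Q = φ (MvPolynomial.coeff d P)) →
      ∀ d, MvPolynomial.coeff d (a * Q) =
        φ (MvPolynomial.coeff d (MvPolynomial.map (algebraMap F L) a * P)) := by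
    classical
    intro φ a P Q hQ d
    simp only [MvPolynomial.coeff_mul, map_sum, MvPolynomial.coeff_map, ← Algebra.smul_def,
      map_smul, hQ, smul_eq_mul]
  refine hf'0 (MvPolynomial.ext _ _ fun d ↦ ?_)
  rw [MvPolynomial.coeff_zero, ← Module.forall_dual_apply_eq_zero_iff F]
  intro φ
  obtain ⟨Q, hQ⟩ := hlin φ f'
  obtain ⟨S, hS⟩ := hlin φ h'
  have hdvd : f ∣ h * Q := ⟨S, MvPolynomial.ext _ _ fun d ↦ by
    rw [hmul φ h f' Q hQ, hmul φ f h' S hS, hcross]⟩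
  have hfQ : f ∣ Q := hfh.dvd_of_dvd_mul_left hdvd
  rw [← hQ]
  by_contra hQd
  have hQ0 : Q ≠ 0 := by rintro rfl; exact hQd (MvPolynomial.coeff_zero _)
  have hle : Q.totalDegree ≤ f'.totalDegree :=
    Finset.sup_mono fun d hd ↦ by
      rw [MvPolynomial.mem_support_iff, hQ] at hd
      rw [MvPolynomial.mem_support_iff]
      intro h0
      exact hd (by rw [h0, map_zero])
  obtain ⟨T, rfl⟩ := hfQ
  rw [totalDegree_mul_of_isDomain hf (right_ne_zero_of_mul hQ0)] at hle
  omega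

end BaseChange

end Assembly

end

lemma eval_zero_mooreDet (R : Type*) [CommRing R] {k : ℕ} (hk : 0 < k) :
    eval 0 (MooreDet R k) = 0 := by
  rw [MooreDet, RingHom.map_det]
  refine Matrix.det_eq_zero_of_row_eq_zero ⟨0, hk⟩ fun j ↦ by simp

/-- The zero locus of a nonzero polynomial is the union of the zero loci of its irreducible
factors. -/
lemma eval_eq_zero_iff_exists_irreducible_dvd {σ K : Type*} [Field K] {P : MvPolynomial σ K}
    (hP : P ≠ 0) (x : σ → K) :
    eval x P = 0 ↔ ∃ g, Irreducible g ∧ g ∣ P ∧ eval x g = 0 := by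
  refine ⟨fun h ↦ ?_, fun ⟨g, _, hgP, hg⟩ ↦ eq_zero_of_zero_dvd (hg ▸ map_dvd (eval x) hgP)⟩
  obtain ⟨c, hc, hcP⟩ := WfDvdMonoid.exists_factors P hP
  have h0 : eval x c.prod = 0 := by
    have := hcP.map (eval x)
    rwa [h, associated_zero_iff_eq_zero] at this
  rw [map_multiset_prod, Multiset.prod_eq_zero_iff, Multiset.mem_map] at h0
  obtain ⟨g, hg, hgx⟩ := h0
  exact ⟨g, hc g hg, (Multiset.dvd_prod hg).trans hcP.dvd, hgx⟩

/-- Lang–Weil-type estimate: let `F` be a finite field with `q` elements, `k ≥ 2`, and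
`f ∈ F[X_1,…,X_k]`.  Suppose that over the algebraic closure `Ω` of `F`, `f` has exactly
`l` distinct irreducible factors (listed, up to associates, by a finset `G` of pairwise
non-associate irreducible polynomials), each of which has all of its coefficients in the
subfield `F_{q^m} = {x ∈ Ω : x^{q^m} = x}`, and that `gcd(f, Δ) = 1` in `F[X_1,…,X_k]`.
Then the number `N_s` of points `x ∈ (F_{q^{ms}})^k` with `f(x) = 0` and `Δ(x) ≠ 0`
satisfies `|N_s − l·(q^{ms})^{k−1}| ≤ C·(q^{ms})^{k−3/2}` for all large `s`. -/
theorem langWeil_count_zeros_off_moore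
    (F : Type*) [Field F] [Fintype F] (k l m : ℕ) (hk : 2 ≤ k) (hm : 1 ≤ m)
    (f : MvPolynomial (Fin k) F)
    (G : Finset (MvPolynomial (Fin k) (AlgebraicClosure F)))
    (hGcard : G.card = l)
    (hGirr : ∀ g ∈ G, Irreducible g)
    (hGcoeff : ∀ g ∈ G, ∀ d, coeff d g ^ Fintype.card F ^ m = coeff d g)
    (hGnonassoc : ∀ g₁ ∈ G, ∀ g₂ ∈ G, Associated g₁ g₂ → g₁ = g₂)
    (hGfactors : ∀ g : MvPolynomial (Fin k) (AlgebraicClosure F), Irreducible g →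
      (g ∣ MvPolynomial.map (algebraMap F (AlgebraicClosure F)) f ↔
        ∃ g' ∈ G, Associated g g'))
    (hgcd : IsRelPrime f (MooreDet F k)) :
    ∃ C : ℝ, 0 < C ∧ ∃ s₀ : ℕ, ∀ s ≥ s₀,
      |({x : Fin k → AlgebraicClosure F |
            (∀ i, x i ^ Fintype.card F ^ (m * s) = x i) ∧
            eval x (MvPolynomial.map (algebraMap F (AlgebraicClosure F)) f) = 0 ∧
            eval x (MvPolynomial.map (algebraMap F (AlgebraicClosure F))
              (MooreDet F k)) ≠ 0}.ncard : ℝ)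
          - l * ((Fintype.card F : ℝ) ^ (m * s)) ^ (k - 1)|
        ≤ C * ((Fintype.card F : ℝ) ^ (m * s)) ^ ((k : ℝ) - 3 / 2) := by
  classical
  obtain ⟨n, rfl⟩ := Nat.exists_eq_add_of_le' hk
  obtain ⟨p, hchar, a, hp, hcard⟩ := FiniteField.card' F
  have : Fact p.Prime := ⟨hp⟩
  have : CharP (AlgebraicClosure F) p := charP_of_injective_algebraMap (algebraMap F _).injective p
  let _ : Algebra (ZMod p) F := ZMod.algebra F p
  have : Algebra.IsAlgebraic (ZMod p) (AlgebraicClosure F) := Algebra.IsAlgebraic.trans _ F _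
  set Δ := MvPolynomial.map (algebraMap F (AlgebraicClosure F)) (MooreDet F (n + 2)) with hΔ
  set f' := MvPolynomial.map (algebraMap F (AlgebraicClosure F)) f with hf'
  have hf0 : f ≠ 0 := by
    rintro rfl
    have h := (isRelPrime_zero_left.1 hgcd).map (eval (0 : Fin (n + 2) → F))
    rw [eval_zero_mooreDet F (by omega)] at h
    exact not_isUnit_zero h
  have hf'0 : f' ≠ 0 := (map_ne_zero_iff _ (map_injective _ (algebraMap F _).injective)).2 hf0
  have hGdvd : ∀ g ∈ G, g ∣ f' := fun g hg ↦ (hGfactors g (hGirr g hg)).2 ⟨g, hg, .refl g⟩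
  have hGΔ : ∀ g ∈ G, ¬ g ∣ Δ := fun g hg h ↦
    (hGirr g hg).not_isUnit (hgcd.map_algebraMap hf0 (hGdvd g hg) h)
  have hzeros : ∀ x, eval x f' = 0 ↔ ∃ g ∈ G, eval x g = 0 := by
    intro x
    rw [eval_eq_zero_iff_exists_irreducible_dvd hf'0]
    constructor
    · rintro ⟨g, hg, hgf, hgx⟩
      obtain ⟨g', hg', hgg'⟩ := (hGfactors g hg).1 hgf
      refine ⟨g', hg', ?_⟩
      have := hgg'.symm.map (eval x)
      rwa [hgx, associated_zero_iff_eq_zero] at this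
    · exact fun ⟨g, hg, hgx⟩ ↦ ⟨g, hGirr g hg, hGdvd g hg, hgx⟩
  obtain ⟨C, K, H⟩ := exists_card_zeros_of_finset p G hGirr
    (fun g hg g' hg' h ↦ hGnonassoc g hg g' hg' ((hGirr g hg).associated_of_dvd (hGirr g' hg') h))
    Δ hGΔ
  refine ⟨C * √p + 1, by positivity, 2 * K + 1, fun s hs ↦ ?_⟩
  set M := (a : ℕ) * (m * s) with hM
  have hMs : s ≤ M := by
    have : 1 ≤ (a : ℕ) * m := Nat.mul_pos a.pos hm
    rw [hM, ← mul_assoc]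
    exact Nat.le_mul_of_pos_left _ this
  have hq : Fintype.card F ^ (m * s) = p ^ (M / 2 + (M - M / 2)) := by
    rw [hcard, ← pow_mul]
    congr 1
    omega
  have hfix : ∀ g ∈ G, ∀ d, coeff d g ^ p ^ (M / 2 + (M - M / 2)) = coeff d g := by
    intro g hg d
    rw [← hq, pow_mul]
    have : ∀ t, coeff d g ^ (Fintype.card F ^ m) ^ t = coeff d g := fun t ↦ by
      induction t with
      | zero => simp
      | succ t ih => rw [pow_succ, pow_mul, ih, hGcoeff g hg]
    exact this s
  have hlt : M - M / 2 < p ^ (M - M / 2) := Nat.lt_pow_self hp.one_lt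
  have hq1 : 1 < p ^ (M / 2 + (M - M / 2)) := Nat.one_lt_pow (by omega) hp.one_lt
  have hcount := H (M / 2) (M - M / 2) (Nat.pow_le_pow_right hp.pos (by omega)) (by omega)
    hq1 hfix
  have hset : {x : Fin (n + 2) → AlgebraicClosure F |
      (∀ i, x i ^ Fintype.card F ^ (m * s) = x i) ∧ eval x f' = 0 ∧ eval x Δ ≠ 0} =
      ((ratPoints (AlgebraicClosure F) (n + 2) (p ^ (M / 2 + (M - M / 2)))).filter fun x ↦
        (∃ g ∈ G, eval x g = 0) ∧ eval x Δ ≠ 0 :) := by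
    ext x
    simp only [Set.mem_ofPred_eq, Finset.coe_filter, mem_ratPoints hq1, hzeros, hq]
  have hqR : (Fintype.card F : ℝ) ^ (m * s) = ((p ^ (M / 2 + (M - M / 2)) : ℕ) : ℝ) := by
    rw [← hq]
    push_cast
    rfl
  rw [hset, Set.ncard_coe_finset, hqR, ← hGcard]
  set N := Finset.card _
  have hsq : p ^ (M - M / 2) * p ^ (M - M / 2) ≤ p * p ^ (M / 2 + (M - M / 2)) := by
    rw [← pow_add, ← pow_succ']
    exact Nat.pow_le_pow_right hp.pos (by omega)
  set t := p ^ (M - M / 2)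
  set q := p ^ (M / 2 + (M - M / 2))
  have hq0 : (0 : ℝ) < q := by exact_mod_cast (by omega : 0 < q)
  have hexp : (q : ℝ) ^ (((n + 2 : ℕ) : ℝ) - 3 / 2) = (q : ℝ) ^ n * √q := by
    rw [Real.sqrt_eq_rpow, ← Real.rpow_natCast, ← Real.rpow_add hq0]
    congr 1
    push_cast
    ring
  have ht : (t : ℝ) ≤ √p * √q := by
    rw [← Real.sqrt_mul (Nat.cast_nonneg p)]
    refine Real.le_sqrt_of_sq_le ?_
    rw [sq]
    exact_mod_cast hsq
  have hC : (C : ℝ) * ((q : ℝ) ^ n * t) ≤ (C * √p + 1) * ((q : ℝ) ^ n * √q) := by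
    calc (C : ℝ) * ((q : ℝ) ^ n * t) ≤ C * ((q : ℝ) ^ n * (√p * √q)) := by gcongr
      _ = C * √p * ((q : ℝ) ^ n * √q) := by ring
      _ ≤ _ := by gcongr; linarith
  have h1 : (N : ℝ) ≤ G.card * (q : ℝ) ^ (n + 1) + C * ((q : ℝ) ^ n * t) := by
    exact_mod_cast hcount.1
  have h2 : G.card * (q : ℝ) ^ (n + 1) ≤ (N : ℝ) + C * ((q : ℝ) ^ n * t) := by
    exact_mod_cast hcount.2
  rw [hexp, show n + 2 - 1 = n + 1 by omega, abs_le]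
  constructor <;> linarith
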